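/- Let (R, 𝔪) be an unmixed Noetherian local ring of dimension d ≥ 2 with infinite residue field. Assume there exists an integer n such that for every parameter ideal 𝔮 ⊆ 𝔪ⁿ one has 𝒩(𝔮;R) ≤ e₁(𝔮:𝔪) − e₁(𝔮). Then R is Cohen–Macaulay. -/

import Mathlib

open CategoryTheory IsLocalRing

noncomputable section

/-- The length of a module, defined as the Krull dimension of its submodule lattice. -/
def moduleLength (R M : Type) [CommRing R] [AddCommGroup M] [Module R M] : WithBot ℕ∞ :=
  Order.krullDim (Submodule R M)

variable (R : Type) [CommRing R] [IsLocalRing R]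

/-- `q` is a parameter ideal of the `d`-dimensional local ring `R`:
it is generated by `d` elements and is `𝔪`-primary (its radical is `𝔪`). -/
def IsParameterIdeal (d : ℕ) (q : Ideal R) : Prop :=
  (∃ x : Fin d → R, q = Ideal.span (Set.range x)) ∧ q.radical = maximalIdeal R

/-- `e` is the sequence of Hilbert coefficients of the `𝔪`-primary ideal `I`:
for all large `n`, `ℓ(R/Iⁿ⁺¹) = Σ_{i=0}^d (-1)^i e_i C(n+d-i, d-i)`. -/
def IsHilbertCoeffs (d : ℕ) (I : Ideal R) (e : ℕ → ℤ) : Prop :=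
  ∃ N : ℕ, ∀ n ≥ N, ∃ L : ℕ,
    moduleLength R (R ⧸ I ^ (n + 1)) = (L : ℕ∞) ∧
    (L : ℤ) = ∑ i ∈ Finset.range (d + 1),
      (-1 : ℤ) ^ i * e i * ((n + d - i).choose (d - i) : ℤ)

/-- The index of reducibility `𝒩(q;R) = ℓ_R((q :_R 𝔪)/q)`. -/
def indexOfReducibility (q : Ideal R) : WithBot ℕ∞ :=
  moduleLength R
    (↥(q.colon (maximalIdeal R)) ⧸ (Submodule.comap (q.colon (maximalIdeal R)).subtype q))

/-- `R` is unmixed of dimension `d`: `dim (R̂/P) = d` for every associated prime `P`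
of the `𝔪`-adic completion `R̂` of `R`. -/
def IsUnmixed (d : ℕ) : Prop :=
  ∀ P ∈ associatedPrimes (AdicCompletion (maximalIdeal R) R) (AdicCompletion (maximalIdeal R) R),
    ringKrullDim ((AdicCompletion (maximalIdeal R) R) ⧸ P) = (d : WithBot ℕ∞)

/-- The depth of a local ring `A`, as the least `i` such that `Ext^i(k, A) ≠ 0`. -/
def extDepth (A : Type) [CommRing A] [IsLocalRing A] : ℕ∞ :=
  sInf {n : ℕ∞ | ∃ m : ℕ, n = (m : ℕ∞) ∧
    Nontrivial (((Ext A (ModuleCat A) m).obj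
      (Opposite.op (ModuleCat.of A (ResidueField A)))).obj (ModuleCat.of A A))}

/-- A local ring is Cohen–Macaulay if its depth equals its Krull dimension. -/
def IsCohenMacaulay (A : Type) [CommRing A] [IsLocalRing A] : Prop :=
  (extDepth A : WithBot ℕ∞) = ringKrullDim A

/-- The Cohen–Macaulay type `r(R) = ℓ_R(Ext^d_R(R/𝔪, R))`. -/
def cmType (d : ℕ) : WithBot ℕ∞ :=
  moduleLength R (((Ext R (ModuleCat R) d).obj
      (Opposite.op (ModuleCat.of R (R ⧸ maximalIdeal R)))).obj (ModuleCat.of R R))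

/-- `f` is the sequence of coefficients of the polynomial that agrees with
`n ↦ ℓ((Iⁿ :_R 𝔪)/Iⁿ)` for all large `n`; `f 0` is the irreducible multiplicity `f₀(I)`. -/
def IsIrrCoeffs (d : ℕ) (I : Ideal R) (f : ℕ → ℤ) : Prop :=
  ∃ N : ℕ, ∀ n ≥ N, ∃ L : ℕ,
    indexOfReducibility R (I ^ n) = (L : ℕ∞) ∧
    (L : ℤ) = ∑ i ∈ Finset.range d,
      (-1 : ℤ) ^ i * f i * ((n + (d - 1) - i).choose (d - 1 - i) : ℤ)

/-- `R` is a generalized Cohen–Macaulay ring of dimension `d`: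
the local cohomology modules `H^i_𝔪(R)` have finite length for all `i < d`. -/
def IsGeneralizedCM (d : ℕ) : Prop :=
  ∀ i < d, ∃ L : ℕ,
    moduleLength R ↥((localCohomology (maximalIdeal R) i).obj (ModuleCat.of R R)) = (L : ℕ∞)

/-- `r_i(R) = dim_k ((0) :_{H^i_𝔪(R)} 𝔪)`, the length of the socle of the `i`-th
local cohomology module of `R`. -/
def socLocalCohomology (i : ℕ) : WithBot ℕ∞ :=
  moduleLength R
    ↥(Submodule.torsionBySet R ↥((localCohomology (maximalIdeal R) i).obj (ModuleCat.of R R))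
      (maximalIdeal R : Set R))

/-- A system of parameters `x₁, …, x_d` is standard if
`𝔮·H^i_𝔪(R/(x₁,…,x_j)R) = 0` for all `i + j < d`, where `𝔮 = (x₁,…,x_d)`. -/
def IsStandardSOP (d : ℕ) (x : Fin d → R) : Prop :=
  (Ideal.span (Set.range x)).radical = maximalIdeal R ∧
  ∀ i j : ℕ, i + j < d →
    ∀ a ∈ Ideal.span (Set.range x),
      ∀ v : ((localCohomology (maximalIdeal R) i).obj
        (ModuleCat.of R (R ⧸ Ideal.span (x '' {k : Fin d | (k : ℕ) < j})))), a • v = 0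

/-- `R` is a regular local ring of dimension `d`: `𝔪` is generated by `d` elements. -/
def IsRegularLocal (d : ℕ) : Prop :=
  ∃ x : Fin d → R, maximalIdeal R = Ideal.span (Set.range x)

/-- `R` is Gorenstein: `R` is Cohen–Macaulay of Cohen–Macaulay type `r(R) = 1`. -/
def IsGorenstein (d : ℕ) : Prop :=
  IsCohenMacaulay R ∧ cmType R d = 1

section
variable {R}

/-- The saturation of an ideal `J` of a local ring with respect to the maximal ideal. -/
def saturation (J : Ideal R) : Ideal R where
  carrier := {a | ∃ k : ℕ, ∀ r ∈ maximalIdeal R ^ k, r * a ∈ J}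
  add_mem' := by
    rintro a b ⟨k, hk⟩ ⟨l, hl⟩
    refine ⟨k + l, fun r hr => ?_⟩
    rw [mul_add]
    exact J.add_mem (hk r (Ideal.pow_le_pow_right (Nat.le_add_right k l) hr))
      (hl r (Ideal.pow_le_pow_right (Nat.le_add_left l k) hr))
  zero_mem' := ⟨0, by simp⟩
  smul_mem' := by
    rintro c a ⟨k, hk⟩
    refine ⟨k, fun r hr => ?_⟩
    rw [smul_eq_mul, mul_left_comm]
    exact J.mul_mem_left c (hk r hr)

theorem mem_saturation {J : Ideal R} {a : R} :
    a ∈ saturation J ↔ ∃ k : ℕ, ∀ r ∈ maximalIdeal R ^ k, r * a ∈ J := Iff.rfl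

theorem le_saturation (J : Ideal R) : J ≤ saturation J :=
  fun _ ha => ⟨0, fun r _ => J.mul_mem_left r ha⟩

theorem saturation_mono {J J' : Ideal R} (h : J ≤ J') : saturation J ≤ saturation J' :=
  fun _ ⟨k, hk⟩ => ⟨k, fun r hr => h (hk r hr)⟩

theorem exists_pow_mul_saturation [IsNoetherianRing R] (J : Ideal R) :
    ∃ k : ℕ, ∀ r ∈ maximalIdeal R ^ k, ∀ a ∈ saturation J, r * a ∈ J := by
  obtain ⟨s, hs⟩ := (isNoetherianRing_iff_ideal_fg R).1 inferInstance (saturation J)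
  have h : ∀ a ∈ s, ∃ k : ℕ, ∀ r ∈ maximalIdeal R ^ k, r * a ∈ J := fun a ha =>
    mem_saturation.1 (hs ▸ Ideal.subset_span ha)
  choose! k hk using h
  refine ⟨s.sup k, fun r hr a ha => ?_⟩
  rw [← hs] at ha
  induction ha using Submodule.span_induction with
  | mem x hx => exact hk x hx r (Ideal.pow_le_pow_right (Finset.le_sup hx) hr)
  | zero => simp
  | add x y _ _ hx hy => rw [mul_add]; exact J.add_mem hx hy
  | smul c x _ hx => rw [smul_eq_mul, mul_left_comm]; exact J.mul_mem_left c hx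

theorem mem_saturation_of_pow [IsNoetherianRing R] {J : Ideal R} {a : R} (k : ℕ)
    (h : ∀ r ∈ maximalIdeal R ^ k, r * a ∈ saturation J) : a ∈ saturation J := by
  obtain ⟨l, hl⟩ := exists_pow_mul_saturation J
  refine ⟨l + k, fun r hr => ?_⟩
  rw [pow_add] at hr
  induction hr using Submodule.mul_induction_on' with
  | mem_mul_mem x hx y hy => rw [mul_assoc]; exact hl x hx _ (h y hy)
  | add x _ y _ hx hy => rw [add_mul]; exact J.add_mem hx hy

theorem mem_saturation_of_maximalIdeal [IsNoetherianRing R] {J : Ideal R} {a : R}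
    (h : ∀ r ∈ maximalIdeal R, r * a ∈ saturation J) : a ∈ saturation J :=
  mem_saturation_of_pow 1 (by simpa using h)

theorem mem_colon_maximalIdeal {J : Ideal R} {a : R} :
    a ∈ J.colon (maximalIdeal R) ↔ ∀ r ∈ maximalIdeal R, r * a ∈ J := by
  rw [Submodule.mem_colon]
  simp [mul_comm]

theorem le_colon_maximalIdeal (J : Ideal R) : J ≤ J.colon (maximalIdeal R) :=
  fun _ ha => mem_colon_maximalIdeal.2 fun r _ => J.mul_mem_left r ha

theorem colon_maximalIdeal_le_saturation (J : Ideal R) :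
    J.colon (maximalIdeal R) ≤ saturation J :=
  fun _ ha => ⟨1, by simpa using mem_colon_maximalIdeal.1 ha⟩

theorem saturation_eq_top_iff [IsNoetherianRing R] {J : Ideal R} :
    saturation J = ⊤ ↔ ∃ k : ℕ, maximalIdeal R ^ k ≤ J := by
  rw [Ideal.eq_top_iff_one, mem_saturation]
  simp [SetLike.le_def]

theorem maximalIdeal_notMem_associatedPrimes_quotient_saturation [IsNoetherianRing R]
    (J : Ideal R) : maximalIdeal R ∉ associatedPrimes R (R ⧸ saturation J) := by
  intro hass
  obtain ⟨hp, x, hx⟩ := isAssociatedPrime_iff.1 hass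
  obtain ⟨a, rfl⟩ := Ideal.Quotient.mk_surjective x
  have hmem : ∀ r, r ∈ (maximalIdeal R) ↔ r * a ∈ saturation J := by
    intro r
    rw [← Ideal.Quotient.eq_zero_iff_mem (I := saturation J), map_mul, ← Submodule.mem_bot R]
    conv_lhs => rw [hx, Submodule.mem_colon_singleton]
    rfl
  have ha : a ∈ saturation J := mem_saturation_of_maximalIdeal fun r hr => (hmem r).1 hr
  have h1 : (1 : R) ∈ maximalIdeal R := (hmem 1).2 (by simpa using ha)
  exact hp.ne_top ((Ideal.eq_top_iff_one _).2 h1)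

/-- Elements avoiding suitable finitely many nonmaximal primes are regular modulo the
saturation of `J` and avoid the nonmaximal minimal primes of `J`. -/
theorem exists_finite_primes [IsNoetherianRing R] (J : Ideal R) :
    ∃ F : Set (Ideal R), F.Finite ∧ (∀ P ∈ F, P.IsPrime ∧ P ≠ maximalIdeal R) ∧
      ∀ z : R, (∀ P ∈ F, z ∉ P) →
        (∀ a, z * a ∈ saturation J → a ∈ saturation J) ∧
        (∀ P ∈ J.minimalPrimes, P ≠ maximalIdeal R → z ∉ P) := by
  refine ⟨associatedPrimes R (R ⧸ saturation J) ∪ (J.minimalPrimes \ {maximalIdeal R}),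
    ((associatedPrimes.finite R _)).union
      ((Ideal.finite_minimalPrimes_of_isNoetherianRing R J).sdiff), ?_, fun z hz => ⟨?_, ?_⟩⟩
  · rintro P (hP | hP)
    · exact ⟨hP.1, fun h => maximalIdeal_notMem_associatedPrimes_quotient_saturation J (h ▸ hP)⟩
    · exact ⟨hP.1.1.1, hP.2⟩
  · intro a ha
    by_contra hna
    have hz' : z ∈ ⋃ p ∈ associatedPrimes R (R ⧸ saturation J), (p : Set R) := by
      rw [biUnion_associatedPrimes_eq_zero_divisors]
      refine ⟨Ideal.Quotient.mk _ a, fun h => hna (Ideal.Quotient.eq_zero_iff_mem.1 h), ?_⟩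
      exact Ideal.Quotient.eq_zero_iff_mem.2 ha
    simp only [Set.mem_iUnion] at hz'
    obtain ⟨P, hP, hzP⟩ := hz'
    exact hz P (Or.inl hP) hzP
  · exact fun P hP hne => hz P (Or.inr ⟨hP, hne⟩)

theorem exists_mem_pow_notMem [IsNoetherianRing R] {F : Set (Ideal R)} (hF : F.Finite)
    (hp : ∀ P ∈ F, P.IsPrime ∧ P ≠ maximalIdeal R) (L : ℕ) :
    ∃ z ∈ maximalIdeal R ^ L, ∀ P ∈ F, z ∉ P := by
  by_contra! hcon
  have hsub : ((maximalIdeal R ^ L : Ideal R) : Set R) ⊆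
      ⋃ P ∈ (hF.toFinset : Set (Ideal R)), (P : Set R) := by
    intro z hz
    obtain ⟨P, hP, hzP⟩ := hcon z hz
    simp only [Set.mem_iUnion]
    exact ⟨P, by simpa using hP, hzP⟩
  rw [Ideal.subset_union_prime ⊥ ⊥ (fun P hP _ _ => (hp P (by simpa using hP)).1)] at hsub
  obtain ⟨P, hP, hle⟩ := hsub
  obtain ⟨hP1, hP2⟩ := hp P (by simpa using hP)
  exact hP2 ((maximalIdeal.isMaximal R).eq_of_le hP1.ne_top (hP1.le_of_pow_le hle)).symm

theorem exists_pow_inf_le_pow_mul {A : Type*} [CommRing A] [IsNoetherianRing A] (I N : Ideal A) :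
    ∃ k : ℕ, ∀ n : ℕ, I ^ (n + k) ⊓ N ≤ I ^ n * N := by
  obtain ⟨k, hk⟩ := Ideal.exists_pow_inf_eq_pow_smul I N
  refine ⟨k, fun n => ?_⟩
  have h := hk (n + k) (Nat.le_add_left k n)
  rw [Nat.add_sub_cancel, smul_eq_mul, Ideal.mul_top] at h
  rw [h]
  exact Ideal.mul_mono_right inf_le_right

theorem exists_pow_sup_inf_saturation_le [IsNoetherianRing R] (J : Ideal R) :
    ∃ l : ℕ, ∀ a ∈ maximalIdeal R ^ l ⊔ J, a ∈ saturation J → a ∈ J := by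
  obtain ⟨k, hk⟩ := exists_pow_inf_le_pow_mul (maximalIdeal R) (saturation J)
  obtain ⟨n, hn⟩ := exists_pow_mul_saturation J
  refine ⟨n + k, fun a ha hU => ?_⟩
  obtain ⟨p, hp, j, hj, rfl⟩ := Submodule.mem_sup.1 ha
  have hpU : p ∈ saturation J := by
    simpa using (saturation J).sub_mem hU (le_saturation J hj)
  exact J.add_mem (Ideal.mul_le.2 (fun r hr b hb => hn r hr b hb) (hk n ⟨hp, hpU⟩)) hj

theorem exists_pow_colon_le_pow_sup_saturation [IsNoetherianRing R] (J : Ideal R) (l : ℕ) :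
    ∃ k : ℕ, ∀ e, (∀ r ∈ maximalIdeal R, r * e ∈ maximalIdeal R ^ k ⊔ saturation J) →
      e ∈ maximalIdeal R ^ l ⊔ saturation J := by
  obtain ⟨F, hF, hFp, hFz⟩ := exists_finite_primes J
  obtain ⟨z, hz, hzF⟩ := exists_mem_pow_notMem hF hFp 1
  rw [pow_one] at hz
  obtain ⟨c, hc⟩ := exists_pow_inf_le_pow_mul (maximalIdeal R) (Ideal.span {z} ⊔ saturation J)
  refine ⟨l + c, fun e he => ?_⟩
  obtain ⟨p, hp, u, hu, hpu⟩ := Submodule.mem_sup.1 (he z hz)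
  have hpN : p ∈ Ideal.span {z} ⊔ saturation J := by
    rw [eq_sub_of_add_eq hpu]
    exact Ideal.sub_mem _
      (Ideal.mem_sup_left (Ideal.mul_mem_right _ _ (Ideal.mem_span_singleton_self z)))
      (Ideal.mem_sup_right hu)
  have h1 := hc l ⟨hp, hpN⟩
  rw [Ideal.mul_sup] at h1
  obtain ⟨b, hb, w, hw, hbw⟩ := Submodule.mem_sup.1 h1
  rw [mul_comm, Ideal.mem_span_singleton_mul] at hb
  obtain ⟨t, ht, rfl⟩ := hb
  have hzet : z * (e - t) ∈ saturation J := by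
    have : z * (e - t) = w + u := by rw [mul_sub, ← hpu, ← hbw]; ring
    rw [this]
    exact Ideal.add_mem _
      ((Ideal.mul_le_right : maximalIdeal R ^ l * saturation J ≤ saturation J) hw) hu
  have h2 : e - t ∈ saturation J := (hFz z hzF).1 _ hzet
  have h3 := Ideal.add_mem _ (Ideal.mem_sup_left (T := saturation J) ht) (Ideal.mem_sup_right h2)
  rwa [add_sub_cancel] at h3

theorem exists_pow_colon_sup_saturation [IsNoetherianRing R] (J : Ideal R) :
    ∃ K : ℕ, ∀ q : Ideal R, J ≤ q → q ≤ maximalIdeal R ^ K ⊔ J →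
      ∀ e, (∀ r ∈ maximalIdeal R, r * e ∈ q ⊔ saturation J) →
        e ∈ q.colon (maximalIdeal R) ⊔ saturation J := by
  obtain ⟨l, hl⟩ := exists_pow_sup_inf_saturation_le J
  obtain ⟨k, hk⟩ := exists_pow_colon_le_pow_sup_saturation J l
  refine ⟨max k l, fun q hJq hq e he => ?_⟩
  have h1 : e ∈ maximalIdeal R ^ l ⊔ saturation J := by
    refine hk e fun r hr => (sup_le (hq.trans ?_) le_sup_right : q ⊔ saturation J ≤ _) (he r hr)
    exact sup_le_sup (Ideal.pow_le_pow_right (le_max_left k l)) (le_saturation J)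
  have hql : q ≤ maximalIdeal R ^ l ⊔ J :=
    hq.trans (sup_le_sup (Ideal.pow_le_pow_right (le_max_right k l)) le_rfl)
  obtain ⟨e', he', u, hu, rfl⟩ := Submodule.mem_sup.1 h1
  refine Submodule.mem_sup.2 ⟨e', mem_colon_maximalIdeal.2 fun r hr => ?_, u, hu, rfl⟩
  obtain ⟨p, hp, w, hw, hpw⟩ := Submodule.mem_sup.1 (he r hr)
  have hs : r * e' - p ∈ saturation J := by
    have : r * e' - p = w - r * u := by linear_combination -hpw
    rw [this]
    exact Ideal.sub_mem _ hw (Ideal.mul_mem_left _ _ hu)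
  have := hl _ (Ideal.sub_mem _ (Ideal.mem_sup_left (Ideal.mul_mem_left _ r he')) (hql hp)) hs
  simpa using q.add_mem (hJq this) hp

section
variable {A : Type*} [CommRing A]

/-- The ideal generated by the cubes of the first `i` terms of a sequence. -/
def cubeSpan (z : ℕ → A) (i : ℕ) : Ideal A := Ideal.span ((fun j => z j ^ 3) '' Set.Iio i)

theorem cubeSpan_zero (z : ℕ → A) : cubeSpan z 0 = ⊥ := by simp [cubeSpan]

theorem cubeSpan_mono (z : ℕ → A) : Monotone (cubeSpan z) := fun _ _ h =>
  Ideal.span_mono (Set.image_mono (Set.Iio_subset_Iio h))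

theorem pow_three_mem_cubeSpan (z : ℕ → A) {i j : ℕ} (h : i < j) : z i ^ 3 ∈ cubeSpan z j :=
  Ideal.subset_span ⟨i, h, rfl⟩

theorem cubeSpan_le {z : ℕ → A} {i : ℕ} {J : Ideal A} :
    cubeSpan z i ≤ J ↔ ∀ j < i, z j ^ 3 ∈ J := by
  rw [cubeSpan, Ideal.span_le]
  simp [Set.subset_def]

theorem cubeSpan_succ (z : ℕ → A) (i : ℕ) :
    cubeSpan z (i + 1) = Ideal.span {z i ^ 3} ⊔ cubeSpan z i := by
  have h : Set.Iio (i + 1) = insert i (Set.Iio i) := by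
    ext j; simp only [Set.mem_Iio, Set.mem_insert_iff]; omega
  rw [cubeSpan, h, Set.image_insert_eq, Ideal.span_insert]; rfl

theorem mem_cubeSpan_succ {z : ℕ → A} {i : ℕ} {a : A} :
    a ∈ cubeSpan z (i + 1) ↔ ∃ c, ∃ p ∈ cubeSpan z i, z i ^ 3 * c + p = a := by
  simp_rw [cubeSpan_succ, Submodule.mem_sup, Ideal.mem_span_singleton']
  constructor
  · rintro ⟨_, ⟨c, rfl⟩, p, hp, rfl⟩
    exact ⟨c, p, hp, by ring⟩
  · rintro ⟨c, p, hp, rfl⟩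
    exact ⟨_, ⟨c, rfl⟩, p, hp, by ring⟩

theorem cubeSpan_congr {z z' : ℕ → A} {i : ℕ} (h : ∀ j < i, z j = z' j) :
    cubeSpan z i = cubeSpan z' i := by
  rw [cubeSpan, cubeSpan]
  congr 1
  exact Set.image_congr fun j hj => by rw [h j hj]

end

/-- A sequence whose cubes generate a parameter ideal of the kind used to test the
Cohen–Macaulay property: each term is regular modulo the saturations of the preceding partial
ideals, kills their saturations, and socles modulo those saturations lift. -/
structure IsGoodSeq (z : ℕ → R) (d : ℕ) : Prop where
  mem_max : ∀ i < d, z i ∈ maximalIdeal R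
  regular : ∀ i j, i ≤ j → j < d → ∀ a, z j * a ∈ saturation (cubeSpan z i) →
    a ∈ saturation (cubeSpan z i)
  mul_mem : ∀ i j, i ≤ j → j < d → ∀ a ∈ saturation (cubeSpan z i), z j * a ∈ cubeSpan z i
  colon : ∀ i < d, ∀ e, (∀ r ∈ maximalIdeal R, r * e ∈ cubeSpan z d ⊔ saturation (cubeSpan z i)) →
    e ∈ (cubeSpan z d).colon (maximalIdeal R) ⊔ saturation (cubeSpan z i)
  not_pow_le : ∀ i < d, ∀ K : ℕ, ¬ maximalIdeal R ^ K ≤ cubeSpan z i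
  pow_le : ∃ K : ℕ, maximalIdeal R ^ K ≤ cubeSpan z d

theorem exists_seq_of_step {A : Type*} [CommRing A] (P : Ideal A → A → Prop)
    (hP : ∀ S : Set (Ideal A), S.Finite → ∃ x, ∀ J ∈ S, P J x) (d : ℕ) :
    ∃ z : ℕ → A, ∀ j < d, ∀ i ≤ j, P (cubeSpan z i) (z j) := by
  induction d with
  | zero => exact ⟨0, by simp⟩
  | succ d ih =>
    obtain ⟨z, hz⟩ := ih
    obtain ⟨x, hx⟩ := hP (cubeSpan z '' Set.Iic d) ((Set.finite_Iic d).image _)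
    refine ⟨Function.update z d x, fun j hj i hi => ?_⟩
    have hc : cubeSpan (Function.update z d x) i = cubeSpan z i :=
      cubeSpan_congr fun k hk => Function.update_of_ne (by omega) _ _
    rw [hc]
    rcases Nat.lt_succ_iff_lt_or_eq.1 hj with h | rfl
    · rw [Function.update_of_ne (by omega)]
      exact hz j h i hi
    · rw [Function.update_self]
      exact hx _ ⟨i, hi, rfl⟩

theorem le_height_of_avoid [IsNoetherianRing R] {z : ℕ → R} {d : ℕ}
    (h : ∀ i < d, ∀ P ∈ (cubeSpan z i).minimalPrimes, P ≠ maximalIdeal R → z i ∉ P) :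
    ∀ i ≤ d, ∀ P : Ideal R, P.IsPrime → cubeSpan z i ≤ P → P ≠ maximalIdeal R →
      (i : ℕ∞) ≤ P.height := by
  intro i
  induction i with
  | zero => simp
  | succ i ih =>
    intro hi P hP hle hne
    obtain ⟨P', hP', hPP'⟩ := Ideal.exists_minimalPrimes_le
      ((cubeSpan_mono z (Nat.le_succ i)).trans hle)
    have hprime : P'.IsPrime := hP'.1.1
    have hne' : P' ≠ maximalIdeal R := by
      rintro rfl
      exact hne ((maximalIdeal.isMaximal R).eq_of_le hP.ne_top hPP').symm
    have hz := h i hi P' hP' hne'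
    have hlt : P' < P := by
      refine lt_of_le_of_ne hPP' ?_
      rintro rfl
      exact hz (hprime.mem_of_pow_mem 3 (hle (pow_three_mem_cubeSpan z (Nat.lt_succ_self i))))
    have h1 := Ideal.height_add_one_le_of_lt_of_isPrime hlt
    push_cast
    exact (by gcongr; exact ih (by omega) P' hprime hP'.1.2 hne' :
      (i : ℕ∞) + 1 ≤ P'.height + 1).trans h1

theorem exists_pow_le_of_minimalPrimes [IsNoetherianRing R] {J : Ideal R}
    (h : ∀ P ∈ J.minimalPrimes, P = maximalIdeal R) : ∃ K : ℕ, maximalIdeal R ^ K ≤ J := by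
  refine Ideal.exists_pow_le_of_le_radical_of_fg ?_ (IsNoetherian.noetherian _)
  rw [← Ideal.sInf_minimalPrimes]
  exact le_sInf fun P hP => (h P hP).ge

theorem not_pow_le_cubeSpan [IsNoetherianRing R] {d : ℕ} (hdim : ringKrullDim R = d)
    {z : ℕ → R} (hz : ∀ j < d, z j ∈ maximalIdeal R) {i : ℕ} (hi : i < d) (K : ℕ) :
    ¬ maximalIdeal R ^ K ≤ cubeSpan z i := by
  intro hK
  have hle : cubeSpan z i ≤ maximalIdeal R := cubeSpan_le.2 fun j hj =>
    Ideal.pow_mem_of_mem _ (hz j (by omega)) 3 (by norm_num)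
  have hmin : maximalIdeal R ∈ (cubeSpan z i).minimalPrimes := by
    refine ⟨⟨(maximalIdeal.isMaximal R).isPrime, hle⟩, fun P hP _ => ?_⟩
    exact hP.1.le_of_pow_le (hK.trans hP.2)
  have h1 := Ideal.height_le_card_of_mem_minimalPrimes_span ((Set.finite_Iio i).image _) hmin
  have h2 : ((fun j => z j ^ 3) '' Set.Iio i).ncard ≤ i := by
    refine (Set.ncard_image_le (Set.finite_Iio i)).trans ?_
    simp [Set.ncard_eq_toFinset_card']
  have h3 : ((maximalIdeal R).height : WithBot ℕ∞) = d := by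
    rw [IsLocalRing.maximalIdeal_height_eq_ringKrullDim, hdim]
  have h4 : (maximalIdeal R).height = d := by exact_mod_cast h3
  rw [h4] at h1
  have h5 : d ≤ i := (by exact_mod_cast h1 : d ≤ _).trans h2
  omega

theorem exists_isGoodSeq [IsNoetherianRing R] {d : ℕ} (hdim : ringKrullDim R = d) (n : ℕ) :
    ∃ z : ℕ → R, IsGoodSeq z d ∧ cubeSpan z d ≤ maximalIdeal R ^ n := by
  choose F hF hFp hFz using exists_finite_primes (R := R)
  choose k hk using exists_pow_mul_saturation (R := R)
  choose c hc using exists_pow_colon_sup_saturation (R := R)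
  obtain ⟨z, hz⟩ := exists_seq_of_step (A := R)
    (fun J x => x ∈ maximalIdeal R ∧ x ∈ maximalIdeal R ^ n ∧ x ∈ maximalIdeal R ^ k J ∧
      x ∈ maximalIdeal R ^ c J ∧ ∀ P ∈ F J, x ∉ P) (by
    intro S hS
    obtain ⟨x, hx, hxF⟩ := exists_mem_pow_notMem (R := R) (hS.biUnion fun J _ => hF J)
      (fun P hP => by
        obtain ⟨J, hJ, hPJ⟩ := Set.mem_iUnion₂.1 hP
        exact hFp J P hPJ) (1 + n + hS.toFinset.sup k + hS.toFinset.sup c)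
    refine ⟨x, fun J hJ => ⟨?_, ?_, ?_, ?_, fun P hP => hxF P (Set.mem_iUnion₂.2 ⟨J, hJ, hP⟩)⟩⟩
    · exact pow_one (maximalIdeal R) ▸ Ideal.pow_le_pow_right (by omega) hx
    · exact Ideal.pow_le_pow_right (by omega) hx
    · have := Finset.le_sup (f := k) (hS.mem_toFinset.2 hJ)
      exact Ideal.pow_le_pow_right (by omega) hx
    · have := Finset.le_sup (f := c) (hS.mem_toFinset.2 hJ)
      exact Ideal.pow_le_pow_right (by omega) hx) d
  have hmem : ∀ j < d, z j ∈ maximalIdeal R := fun j hj => (hz j hj j le_rfl).1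
  refine ⟨z, ⟨hmem, ?_, ?_, ?_, fun i hi => not_pow_le_cubeSpan hdim hmem hi, ?_⟩, ?_⟩
  · exact fun i j hij hj => (hFz _ _ (hz j hj i hij).2.2.2.2).1
  · exact fun i j hij hj => hk _ _ (hz j hj i hij).2.2.1
  · refine fun i hi => hc _ _ (cubeSpan_mono z hi.le) (cubeSpan_le.2 fun j hj => ?_)
    by_cases hij : i ≤ j
    · exact Ideal.mem_sup_left (Ideal.pow_mem_of_mem _ (hz j hj i hij).2.2.2.1 3 (by norm_num))
    · exact Ideal.mem_sup_right (pow_three_mem_cubeSpan z (not_le.1 hij))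
  · refine exists_pow_le_of_minimalPrimes fun P hP => ?_
    by_contra hne
    have hprime : P.IsPrime := hP.1.1
    have h1 := le_height_of_avoid (fun i hi => (hFz _ _ (hz i hi i le_rfl).2.2.2.2).2) d le_rfl P
      hprime hP.1.2 hne
    have hlt : P < maximalIdeal R := lt_of_le_of_ne (le_maximalIdeal hprime.ne_top) hne
    have h2 := Ideal.height_add_one_le_of_lt_of_isPrime hlt
    have h3 : ((maximalIdeal R).height : WithBot ℕ∞) = d := by
      rw [IsLocalRing.maximalIdeal_height_eq_ringKrullDim, hdim]
    have h4 : (maximalIdeal R).height = d := by exact_mod_cast h3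
    rw [h4] at h2
    have h5 : (d : ℕ∞) + 1 ≤ d := le_trans (by gcongr) h2
    have h6 : d + 1 ≤ d := by exact_mod_cast h5
    omega
  · exact cubeSpan_le.2 fun j hj =>
      Ideal.pow_mem_of_mem _ (hz j hj j le_rfl).2.1 3 (by norm_num)

theorem mem_sup_of_le {A : Type*} [CommRing A] {I J I' J' : Ideal A} (hI : I ≤ I') (hJ : J ≤ J')
    {a : A} (h : a ∈ I ⊔ J) : a ∈ I' ⊔ J' := sup_le_sup hI hJ h

theorem mem_cubeSpan_succ_mul {A : Type*} [CommRing A] {z : ℕ → A} {i : ℕ} {a : A} {J : Ideal A}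
    (ha : a ∈ cubeSpan z (i + 1) * J) :
    ∃ e ∈ J, ∃ p ∈ cubeSpan z i * J, z i ^ 3 * e + p = a := by
  rw [cubeSpan_succ, Ideal.sup_mul] at ha
  obtain ⟨b, hb, p, hp, rfl⟩ := Submodule.mem_sup.1 ha
  rw [Ideal.mem_span_singleton_mul] at hb
  obtain ⟨e, he, rfl⟩ := hb
  exact ⟨e, he, p, hp, rfl⟩

theorem mul_mem_mul_of_mem_mul_colon {q K : Ideal R} {r p : R} (hr : r ∈ maximalIdeal R)
    (hp : p ∈ K * q.colon (maximalIdeal R)) : r * p ∈ K * q := by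
  induction hp using Submodule.mul_induction_on' with
  | mem_mul_mem x hx y hy =>
    rw [mul_left_comm]
    exact Ideal.mul_mem_mul hx (mem_colon_maximalIdeal.1 hy r hr)
  | add x _ y _ hx hy => rw [mul_add]; exact Ideal.add_mem _ hx hy

namespace IsGoodSeq

variable {z : ℕ → R} {d : ℕ}

theorem pow_three_mem_max (hz : IsGoodSeq z d) {i : ℕ} (hi : i < d) :
    z i ^ 3 ∈ maximalIdeal R := Ideal.pow_mem_of_mem _ (hz.mem_max i hi) 3 (by norm_num)

theorem regular_pow_three (hz : IsGoodSeq z d) {i j : ℕ} (hij : i ≤ j) (hj : j < d) {a : R}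
    (ha : z j ^ 3 * a ∈ saturation (cubeSpan z i)) : a ∈ saturation (cubeSpan z i) := by
  refine hz.regular i j hij hj _ (hz.regular i j hij hj _ (hz.regular i j hij hj _ ?_))
  convert ha using 1
  ring

theorem pow_three_mul_mem (hz : IsGoodSeq z d) {i j : ℕ} (hij : i ≤ j) (hj : j < d) {a : R}
    (ha : a ∈ saturation (cubeSpan z i)) : z j ^ 3 * a ∈ cubeSpan z i := by
  have h : z j ^ 3 * a = z j ^ 2 * (z j * a) := by ring
  rw [h]
  exact Ideal.mul_mem_left _ _ (hz.mul_mem i j hij hj a ha)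

theorem mem_of_mem_saturation (hz : IsGoodSeq z d) {i : ℕ} (hi : i ≤ d) {a : R}
    (ha : a ∈ cubeSpan z d) (hs : a ∈ saturation (cubeSpan z i)) : a ∈ cubeSpan z i := by
  induction hi using Nat.decreasingInduction with
  | self => exact ha
  | of_succ i hi ih =>
    obtain ⟨e, p, hp, rfl⟩ := mem_cubeSpan_succ.1
      (ih (saturation_mono (cubeSpan_mono z (Nat.le_succ i)) hs))
    have h1 : z i ^ 3 * e ∈ saturation (cubeSpan z i) := by
      simpa using Ideal.sub_mem _ hs (le_saturation _ hp)
    exact Ideal.add_mem _ (hz.pow_three_mul_mem le_rfl hi (hz.regular_pow_three le_rfl hi h1)) hp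

theorem pow_inf_cubeSpan_le (hz : IsGoodSeq z d) (n : ℕ) {i : ℕ} (hi : i ≤ d) {a : R}
    (ha : a ∈ cubeSpan z d ^ (n + 1)) (hai : a ∈ cubeSpan z i) :
    a ∈ cubeSpan z i * cubeSpan z d ^ n := by
  induction n generalizing i a with
  | zero => simpa using hai
  | succ n ihn =>
    induction hi using Nat.decreasingInduction with
    | self => rwa [← pow_succ']
    | of_succ i hi ih =>
      obtain ⟨e, he, p, hp, rfl⟩ := mem_cubeSpan_succ_mul
        (ih (cubeSpan_mono z (Nat.le_succ i) hai))
      refine Ideal.add_mem _ ?_ hp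
      have h1 : z i ^ 3 * e ∈ cubeSpan z i := by
        simpa using Ideal.sub_mem _ hai (Ideal.mul_le_left hp)
      have h2 : e ∈ cubeSpan z i := hz.mem_of_mem_saturation hi.le
        (Ideal.pow_le_self (Nat.succ_ne_zero n) he)
        (hz.regular_pow_three le_rfl hi (le_saturation _ h1))
      have h3 := Ideal.mul_mem_mul (pow_three_mem_cubeSpan z hi) (ihn hi.le he h2)
      rwa [mul_left_comm, ← pow_succ'] at h3

theorem exists_sub_mem (hz : IsGoodSeq z d) (n : ℕ) {i : ℕ} (hi : i < d) {a : R}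
    (ha : a ∈ cubeSpan z d ^ (n + 1) ⊔ cubeSpan z i) (hai : a ∈ cubeSpan z (i + 1)) :
    ∃ e ∈ cubeSpan z d ^ n, a - z i ^ 3 * e ∈ cubeSpan z i := by
  obtain ⟨p, hp, w, hw, rfl⟩ := Submodule.mem_sup.1 ha
  have hpQ : p ∈ cubeSpan z (i + 1) := by
    simpa using Ideal.sub_mem _ hai (cubeSpan_mono z (Nat.le_succ i) hw)
  obtain ⟨e, he, p', hp', rfl⟩ := mem_cubeSpan_succ_mul (hz.pow_inf_cubeSpan_le n hi hp hpQ)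
  exact ⟨e, he, by
    convert Ideal.add_mem _ (Ideal.mul_le_left hp') hw using 1
    ring⟩

theorem mem_pow_sup_of_mul_mem (hz : IsGoodSeq z d) (n : ℕ) {i : ℕ} (hi : i < d) {a : R}
    (ha : z i ^ 3 * a ∈ cubeSpan z d ^ (n + 1) ⊔ cubeSpan z i) :
    a ∈ cubeSpan z d ^ n ⊔ saturation (cubeSpan z i) := by
  obtain ⟨e, he, hs⟩ := hz.exists_sub_mem n hi ha
    (Ideal.mul_mem_right _ _ (pow_three_mem_cubeSpan z (Nat.lt_succ_self i)))
  rw [← mul_sub] at hs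
  exact Submodule.mem_sup.2 ⟨e, he, a - e, hz.regular_pow_three le_rfl hi (le_saturation _ hs),
    by ring⟩

/-- Socle lifting modulo the saturation, deduced from socle lifting modulo the ideal. -/
theorem mem_pow_mul_colon_sup_of_colon (hz : IsGoodSeq z d) (n : ℕ) {i : ℕ} (hi : i < d)
    (hE : ∀ a, (∀ r ∈ maximalIdeal R, r * a ∈ cubeSpan z d ^ (n + 1) ⊔ cubeSpan z i) →
      a ∈ cubeSpan z d ^ n * (cubeSpan z d).colon (maximalIdeal R) ⊔
        (cubeSpan z i).colon (maximalIdeal R))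
    {e : R} (he : e ∈ cubeSpan z d ^ n)
    (hr : ∀ r ∈ maximalIdeal R, r * e ∈ cubeSpan z d ^ (n + 1) ⊔ saturation (cubeSpan z i)) :
    e ∈ cubeSpan z d ^ n * (cubeSpan z d).colon (maximalIdeal R) ⊔
      saturation (cubeSpan z i) := by
  cases n with
  | zero => simpa using hz.colon i hi e (by simpa using hr)
  | succ n =>
    refine mem_sup_of_le le_rfl (colon_maximalIdeal_le_saturation _) (hE e fun r hrm => ?_)
    obtain ⟨p, hp, u, hu, hpu⟩ := Submodule.mem_sup.1 (hr r hrm)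
    refine Submodule.mem_sup.2 ⟨p, hp, u, hz.mem_of_mem_saturation hi.le ?_ hu, hpu⟩
    rw [eq_sub_of_add_eq' hpu]
    exact Ideal.sub_mem _ (Ideal.mul_mem_left _ _ (Ideal.pow_le_self (Nat.succ_ne_zero n) he))
      (Ideal.pow_le_self (Nat.succ_ne_zero _) hp)

theorem mem_pow_mul_colon_sup (hz : IsGoodSeq z d) {i : ℕ} (hi : i ≤ d) (n : ℕ) {a : R}
    (ha : ∀ r ∈ maximalIdeal R, r * a ∈ cubeSpan z d ^ (n + 1) ⊔ cubeSpan z i) :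
    a ∈ cubeSpan z d ^ n * (cubeSpan z d).colon (maximalIdeal R) ⊔
      (cubeSpan z i).colon (maximalIdeal R) := by
  induction hi using Nat.decreasingInduction generalizing n a with
  | self =>
    refine Ideal.mem_sup_right (mem_colon_maximalIdeal.2 fun r hr => ?_)
    exact (sup_le (Ideal.pow_le_self (Nat.succ_ne_zero n)) le_rfl : _ ≤ cubeSpan z d) (ha r hr)
  | of_succ i hi ih =>
    induction n generalizing a with
    | zero =>
      refine Ideal.mem_sup_left ?_
      rw [pow_zero, one_mul, mem_colon_maximalIdeal]
      intro r hr
      have := ha r hr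
      rwa [zero_add, pow_one, sup_eq_left.2 (cubeSpan_mono z hi.le)] at this
    | succ k ihk =>
      obtain ⟨p, hp, s, hs, rfl⟩ := Submodule.mem_sup.1 (ih (k + 1) fun r hr =>
        mem_sup_of_le le_rfl (cubeSpan_mono z (Nat.le_succ i)) (ha r hr))
      have hs' := mem_colon_maximalIdeal.1 hs
      have hrs : ∀ r ∈ maximalIdeal R, ∃ e ∈ cubeSpan z d ^ (k + 1),
          r * s - z i ^ 3 * e ∈ cubeSpan z i := by
        intro r hr
        refine hz.exists_sub_mem (k + 1) hi ?_ (hs' r hr)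
        have h1 := Ideal.sub_mem _ (ha r hr) (Ideal.mem_sup_left (T := cubeSpan z i)
          (mul_mem_mul_of_mem_mul_colon hr hp))
        simpa [mul_add] using h1
      obtain ⟨p', hp', hw0⟩ := hrs _ (hz.pow_three_mem_max hi)
      rw [← mul_sub] at hw0
      have hw : s - p' ∈ saturation (cubeSpan z i) :=
        hz.regular_pow_three le_rfl hi (le_saturation _ hw0)
      have hpU : p' ∈ saturation (cubeSpan z (i + 1)) := by
        have := Ideal.sub_mem _ (colon_maximalIdeal_le_saturation _ hs)
          (saturation_mono (cubeSpan_mono z (Nat.le_succ i)) hw)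
        simpa using this
      have hpQ : p' ∈ cubeSpan z (i + 1) := hz.mem_of_mem_saturation hi
        (Ideal.pow_le_self (Nat.succ_ne_zero k) hp') hpU
      obtain ⟨e, he, p'', hp'', hpe⟩ := mem_cubeSpan_succ_mul
        (hz.pow_inf_cubeSpan_le k hi hp' hpQ)
      have hwU : s - z i ^ 3 * e ∈ saturation (cubeSpan z i) := by
        have := Ideal.add_mem _ hw (le_saturation _ (Ideal.mul_le_left hp''))
        convert this using 1
        rw [← hpe]; ring
      have hre : ∀ r ∈ maximalIdeal R, ∃ f ∈ cubeSpan z d ^ (k + 1),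
          r * e - f ∈ saturation (cubeSpan z i) ∧ r * s - z i ^ 3 * f ∈ cubeSpan z i := by
        intro r hr
        obtain ⟨f, hf, hfs⟩ := hrs r hr
        refine ⟨f, hf, hz.regular_pow_three le_rfl hi ?_, hfs⟩
        have := Ideal.sub_mem _ (le_saturation _ hfs) (Ideal.mul_mem_left _ r hwU)
        convert this using 1
        ring
      have heF := hz.mem_pow_mul_colon_sup_of_colon k hi (fun a ha => ihk ha) he fun r hr => by
        obtain ⟨f, hf, hfe, -⟩ := hre r hr
        exact Submodule.mem_sup.2 ⟨f, hf, _, hfe, by ring⟩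
      obtain ⟨g, hg, u, hu, rfl⟩ := Submodule.mem_sup.1 heF
      have hws : s - z i ^ 3 * (g + u) ∈ (cubeSpan z i).colon (maximalIdeal R) := by
        refine mem_colon_maximalIdeal.2 fun r hr => ?_
        obtain ⟨f, hf, hfe, hfs⟩ := hre r hr
        have := Ideal.sub_mem _ hfs (hz.pow_three_mul_mem le_rfl hi hfe)
        convert this using 1
        ring
      have hyg := Ideal.mul_mem_mul (pow_three_mem_cubeSpan z hi) hg
      rw [← mul_assoc, ← pow_succ'] at hyg
      refine Submodule.mem_sup.2 ⟨p + z i ^ 3 * g, Ideal.add_mem _ hp hyg,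
        s - z i ^ 3 * (g + u) + z i ^ 3 * u, Ideal.add_mem _ hws
          (le_colon_maximalIdeal _ (hz.pow_three_mul_mem le_rfl hi hu)), by ring⟩

theorem mem_pow_mul_colon_sup_saturation (hz : IsGoodSeq z d) (n : ℕ) {i : ℕ} (hi : i < d) {a : R}
    (ha : z i ^ 3 * a ∈ cubeSpan z d ^ (n + 1) * (cubeSpan z d).colon (maximalIdeal R) ⊔
      cubeSpan z i) :
    a ∈ cubeSpan z d ^ n * (cubeSpan z d).colon (maximalIdeal R) ⊔
      saturation (cubeSpan z i) := by
  obtain ⟨e, he, u, hu, rfl⟩ := Submodule.mem_sup.1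
    (hz.mem_pow_sup_of_mul_mem n hi (mem_sup_of_le Ideal.mul_le_left le_rfl ha))
  refine Ideal.add_mem _ ?_ (Ideal.mem_sup_right hu)
  refine hz.mem_pow_mul_colon_sup_of_colon n hi (fun a => hz.mem_pow_mul_colon_sup hi.le n) he
    fun r hr => ?_
  have h1 : z i ^ 3 * (r * (e + u)) ∈ cubeSpan z d ^ (n + 1 + 1) ⊔ cubeSpan z i := by
    obtain ⟨p, hp, w, hw, hpw⟩ := Submodule.mem_sup.1 ha
    rw [mul_left_comm, ← hpw, mul_add, pow_succ]
    exact Ideal.add_mem _ (Ideal.mem_sup_left (mul_mem_mul_of_mem_mul_colon hr hp))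
      (Ideal.mem_sup_right (Ideal.mul_mem_left _ _ hw))
  have h2 := Ideal.sub_mem _ (hz.mem_pow_sup_of_mul_mem _ hi h1)
    (Ideal.mem_sup_right (Ideal.mul_mem_left _ r hu))
  convert h2 using 1
  ring

end IsGoodSeq

/-- Krull's intersection theorem modulo an ideal. -/
theorem mem_of_forall_mem_pow_sup [IsNoetherianRing R] {U : Ideal R} {x : R}
    (h : ∀ k : ℕ, x ∈ maximalIdeal R ^ k ⊔ U) : x ∈ U := by
  obtain ⟨c, hc⟩ := exists_pow_inf_le_pow_mul (maximalIdeal R) (Ideal.span {x} ⊔ U)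
  obtain ⟨p, hp, u, hu, hpu⟩ := Submodule.mem_sup.1 (h (1 + c))
  have hpN : p ∈ Ideal.span {x} ⊔ U := by
    rw [eq_sub_of_add_eq hpu]
    exact Ideal.sub_mem _ (Ideal.mem_sup_left (Ideal.mem_span_singleton_self x))
      (Ideal.mem_sup_right hu)
  have h1 := hc 1 ⟨hp, hpN⟩
  rw [pow_one, Ideal.mul_sup] at h1
  obtain ⟨b, hb, w, hw, hbw⟩ := Submodule.mem_sup.1 h1
  rw [mul_comm, Ideal.mem_span_singleton_mul] at hb
  obtain ⟨t, ht, rfl⟩ := hb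
  have hunit : IsUnit (1 - t) := by
    by_contra hn
    have := Ideal.add_mem _ ((mem_maximalIdeal _).2 hn) ht
    rw [sub_add_cancel] at this
    exact (maximalIdeal.isMaximal R).ne_top ((Ideal.eq_top_iff_one _).2 this)
  have h2 : x * (1 - t) ∈ U := by
    have : x * (1 - t) = w + u := by linear_combination -hpu - hbw
    rw [this]
    exact Ideal.add_mem _ (Ideal.mul_le_right hw) hu
  exact (Ideal.mul_unit_mem_iff_mem U hunit).1 h2

theorem pow_le_span_pow_sup {A : Type*} [CommRing A] {I U : Ideal A} {r : A}
    (h : I ≤ Ideal.span {r} ⊔ U) (k : ℕ) : I ^ k ≤ Ideal.span {r ^ k} ⊔ U := by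
  induction k with
  | zero => simp [Ideal.span_singleton_one]
  | succ k ih =>
    rw [pow_succ]
    refine (Ideal.mul_mono ih h).trans ?_
    rw [Ideal.sup_mul, Ideal.mul_sup, Ideal.span_singleton_mul_span_singleton, ← pow_succ]
    exact sup_le (sup_le_sup_left Ideal.mul_le_right _) (Ideal.mul_le_left.trans le_sup_right)

theorem exists_pow_le_span_sup [IsNoetherianRing R] {U : Ideal R} {r : R}
    (hr : r ∈ maximalIdeal R) (h : maximalIdeal R ≤ Ideal.span {r} ⊔ U) {x : R} (hx : x ∉ U) :
    ∃ k : ℕ, maximalIdeal R ^ k ≤ Ideal.span {x} ⊔ U := by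
  classical
  have hex : ∃ k : ℕ, x ∉ Ideal.span {r ^ k} ⊔ U := by
    by_contra! hall
    refine hx (mem_of_forall_mem_pow_sup fun k => mem_sup_of_le ?_ le_rfl (hall k))
    rw [Ideal.span_singleton_le_iff_mem]
    exact Ideal.pow_mem_pow hr k
  have hk0 : Nat.find hex ≠ 0 := fun h0 => by
    have := Nat.find_spec hex
    rw [h0] at this
    simp [Ideal.span_singleton_one] at this
  obtain ⟨k, hk⟩ := Nat.exists_eq_succ_of_ne_zero hk0
  have hxk : x ∈ Ideal.span {r ^ k} ⊔ U := not_not.1 (Nat.find_min hex (m := k) (by omega))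
  obtain ⟨b, hb, u, hu, rfl⟩ := Submodule.mem_sup.1 hxk
  obtain ⟨v, rfl⟩ := Ideal.mem_span_singleton'.1 hb
  have hv : IsUnit v := by
    by_contra hv
    obtain ⟨c, hc, w, hw, hcw⟩ := Submodule.mem_sup.1 (h ((mem_maximalIdeal v).2 hv))
    obtain ⟨t, rfl⟩ := Ideal.mem_span_singleton'.1 hc
    refine Nat.find_spec hex ?_
    rw [hk, ← hcw]
    have h1 := Ideal.add_mem _ (Ideal.mem_sup_left (T := U) (Ideal.mul_mem_left _ t
      (Ideal.mem_span_singleton_self (r ^ (k + 1)))))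
      (Ideal.mem_sup_right (Ideal.add_mem _ (Ideal.mul_mem_right (r ^ k) _ hw) hu))
    convert h1 using 1
    ring
  refine ⟨k, (pow_le_span_pow_sup h k).trans (sup_le ?_ le_sup_right)⟩
  rw [Ideal.span_singleton_le_iff_mem]
  refine (Ideal.unit_mul_mem_iff_mem _ hv).1 ?_
  have h1 := Ideal.sub_mem _ (Ideal.mem_sup_left (T := U)
    (Ideal.mem_span_singleton_self (v * r ^ k + u))) (Ideal.mem_sup_right hu)
  simpa using h1

namespace IsGoodSeq

variable {z : ℕ → R} {d : ℕ}

theorem not_pow_le_saturation [IsNoetherianRing R] (hz : IsGoodSeq z d) {i : ℕ} (hi : i < d)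
    (K : ℕ) : ¬ maximalIdeal R ^ K ≤ saturation (cubeSpan z i) := by
  intro h
  have h1 : (1 : R) ∈ saturation (cubeSpan z i) :=
    mem_saturation_of_pow K fun r hr => by simpa using h hr
  obtain ⟨K, hK⟩ := saturation_eq_top_iff.1 ((Ideal.eq_top_iff_one _).2 h1)
  exact hz.not_pow_le i hi K hK

theorem not_le_radical_saturation [IsNoetherianRing R] (hz : IsGoodSeq z d) {i : ℕ} (hi : i < d) :
    ¬ maximalIdeal R ≤ (saturation (cubeSpan z i)).radical := by
  intro h
  obtain ⟨K, hK⟩ := Ideal.exists_pow_le_of_le_radical_of_fg h (IsNoetherian.noetherian _)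
  exact hz.not_pow_le_saturation hi K hK

theorem not_le_span_sup_saturation [IsNoetherianRing R] (hz : IsGoodSeq z d) (hd : 2 ≤ d) {i : ℕ}
    (hi : i < d) {r : R} (hr : r ∈ maximalIdeal R) :
    ¬ maximalIdeal R ≤ Ideal.span {r} ⊔ saturation (cubeSpan z i) := by
  intro h
  cases i with
  | zero =>
    have hx : z 0 ∉ saturation (cubeSpan z 0) := fun hx => by
      have h1 := hz.regular 0 0 le_rfl hi 1 (by simpa using hx)
      exact hz.not_pow_le_saturation hi 0 (by
        rw [(Ideal.eq_top_iff_one _).2 h1]; exact le_top)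
    have hx3 : z 0 ^ 3 ∉ saturation (cubeSpan z 0) := fun hx3 =>
      hx (hz.regular_pow_three le_rfl hi (Ideal.mul_mem_right _ _ hx3))
    obtain ⟨k, hk⟩ := exists_pow_le_span_sup hr h hx3
    refine hz.not_pow_le_saturation (i := 1) (by omega) k (hk.trans (sup_le ?_ ?_))
    · rw [Ideal.span_singleton_le_iff_mem]
      exact le_saturation _ (pow_three_mem_cubeSpan z (by omega))
    · exact saturation_mono (cubeSpan_mono z (by omega))
  | succ j =>
    by_cases hx : z j ∈ saturation (cubeSpan z (j + 1))
    · obtain ⟨K, hK⟩ := exists_pow_mul_saturation (cubeSpan z (j + 1))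
      refine hz.not_pow_le_saturation hi K fun s hs => ?_
      obtain ⟨c, p, hp, hcp⟩ := mem_cubeSpan_succ.1 (hK s hs _ hx)
      have h1 : s - z j ^ 2 * c ∈ saturation (cubeSpan z j) := by
        refine hz.regular j j le_rfl (by omega) _ (le_saturation _ ?_)
        convert hp using 1
        linear_combination -hcp
      have h2 := Ideal.add_mem _ (saturation_mono (cubeSpan_mono z (Nat.le_succ j)) h1)
        (Ideal.mul_mem_left _ (z j * c) hx)
      convert h2 using 1
      ring
    · obtain ⟨k, hk⟩ := exists_pow_le_span_sup hr h hx
      refine hz.not_le_radical_saturation hi ?_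
      refine fun a ha => Ideal.mem_radical_of_pow_mem (m := k) ?_
      refine (hk.trans (sup_le ?_ Ideal.le_radical)) (Ideal.pow_mem_pow ha k)
      rw [Ideal.span_singleton_le_iff_mem]
      exact ⟨3, le_saturation _ (pow_three_mem_cubeSpan z (Nat.lt_succ_self j))⟩

theorem mul_mem_maximalIdeal_mul [IsNoetherianRing R] (hz : IsGoodSeq z d) (hd : 2 ≤ d) {i : ℕ}
    (hi : i ≤ d) {a : R} (ha : a ∈ (cubeSpan z i).colon (maximalIdeal R)) {r : R}
    (hr : r ∈ maximalIdeal R) : r * a ∈ maximalIdeal R * cubeSpan z i := by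
  induction i generalizing a r with
  | zero => simpa [cubeSpan_zero] using mem_colon_maximalIdeal.1 ha r hr
  | succ i ih =>
    have hi' : i < d := hi
    rw [mem_colon_maximalIdeal] at ha
    have hzm := hz.mem_max i hi'
    obtain ⟨c, p, hp, hcp⟩ := mem_cubeSpan_succ.1 (ha _ hzm)
    have hw : a - z i ^ 2 * c ∈ saturation (cubeSpan z i) := by
      refine hz.regular i i le_rfl hi' _ (le_saturation _ ?_)
      convert hp using 1
      linear_combination -hcp
    have hs : ∀ s ∈ maximalIdeal R, ∃ b, z i * b - s * c ∈ saturation (cubeSpan z i) ∧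
        s * (a - z i ^ 2 * c) - z i ^ 2 * (z i * b - s * c) ∈ cubeSpan z i := by
      intro s hs
      obtain ⟨b, p', hp', hbp⟩ := mem_cubeSpan_succ.1 (ha s hs)
      have h0 : s * (a - z i ^ 2 * c) - z i ^ 2 * (z i * b - s * c) = p' := by
        linear_combination -hbp
      refine ⟨b, ?_, h0 ▸ hp'⟩
      refine hz.regular i i le_rfl hi' _ (hz.regular i i le_rfl hi' _ ?_)
      have := Ideal.sub_mem _ (Ideal.mul_mem_left _ s hw) (le_saturation _ hp')
      convert this using 1
      linear_combination -h0
    have hwc : a - z i ^ 2 * c ∈ (cubeSpan z i).colon (maximalIdeal R) := by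
      refine mem_colon_maximalIdeal.2 fun s hsm => ?_
      obtain ⟨b, hb, hbQ⟩ := hs s hsm
      have h1 := Ideal.mul_mem_left _ (z i) (hz.mul_mem i i le_rfl hi' _ hb)
      convert Ideal.add_mem _ hbQ h1 using 1
      ring
    obtain ⟨b, hb, hbQ⟩ := hs r hr
    by_cases hbm : b ∈ maximalIdeal R
    · have h1 := ih hi'.le hwc hr
      have h2 := Ideal.mul_mem_mul hzm (hz.mul_mem i i le_rfl hi' _ hb)
      have h3 := Ideal.mul_mem_mul hbm (pow_three_mem_cubeSpan z (Nat.lt_succ_self i))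
      have h4 := Ideal.add_mem _ (Ideal.mul_mono_right (cubeSpan_mono z (Nat.le_succ i))
        (Ideal.sub_mem _ h1 h2)) h3
      convert h4 using 1
      ring
    · exfalso
      rw [mem_maximalIdeal, mem_nonunits_iff, not_not] at hbm
      obtain ⟨v, hv⟩ := hbm.exists_left_inv
      have hc : ∀ t, t * c ∈ saturation (cubeSpan z i) → t ∈ saturation (cubeSpan z i) := by
        intro t ht
        refine (Ideal.mul_unit_mem_iff_mem _ hbm).1 (hz.regular i i le_rfl hi' _ ?_)
        have := Ideal.add_mem _ (Ideal.mul_mem_left _ t hb) (Ideal.mul_mem_left _ r ht)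
        convert this using 1
        ring
      refine hz.not_le_span_sup_saturation hd hi' hr fun s hsm => ?_
      obtain ⟨b', hb', -⟩ := hs s hsm
      have h1 : s - v * b' * r ∈ saturation (cubeSpan z i) := by
        refine hc _ ?_
        have := Ideal.sub_mem _ (Ideal.mul_mem_left _ (v * b') hb) hb'
        convert this using 1
        linear_combination (-b' * z i) * hv
      have h2 := Ideal.add_mem _ (Ideal.mem_sup_left (Ideal.mul_mem_left _ (v * b')
        (Ideal.mem_span_singleton_self r))) (Ideal.mem_sup_right h1)
      convert h2 using 1
      ring

theorem maximalIdeal_mul_colon_le [IsNoetherianRing R] (hz : IsGoodSeq z d) (hd : 2 ≤ d) :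
    maximalIdeal R * (cubeSpan z d).colon (maximalIdeal R) ≤ maximalIdeal R * cubeSpan z d :=
  Ideal.mul_le.2 fun _ hr _ ha => hz.mul_mem_maximalIdeal_mul hd le_rfl ha hr

theorem cubeSpan_le_maximalIdeal (hz : IsGoodSeq z d) : cubeSpan z d ≤ maximalIdeal R :=
  cubeSpan_le.2 fun _ hj => hz.pow_three_mem_max hj

theorem colon_le_maximalIdeal [IsNoetherianRing R] (hz : IsGoodSeq z d) (hd : 2 ≤ d) :
    (cubeSpan z d).colon (maximalIdeal R) ≤ maximalIdeal R := by
  refine le_maximalIdeal fun htop => hz.not_pow_le 0 (by omega) 1 ?_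
  have h := hz.maximalIdeal_mul_colon_le hd
  rw [htop, Ideal.mul_top] at h
  have h1 : maximalIdeal R = ⊥ := by
    refine Submodule.eq_bot_of_le_smul_of_le_jacobson_bot (maximalIdeal R) _
      (IsNoetherian.noetherian _) (h.trans (Ideal.mul_mono_right hz.cubeSpan_le_maximalIdeal))
      (maximalIdeal_le_jacobson _)
  rw [pow_one, h1]
  exact bot_le

theorem maximalIdeal_mul_colon_pow_le [IsNoetherianRing R] (hz : IsGoodSeq z d) (hd : 2 ≤ d)
    (n : ℕ) : maximalIdeal R * (cubeSpan z d).colon (maximalIdeal R) ^ n ≤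
      maximalIdeal R * cubeSpan z d ^ n := by
  induction n with
  | zero => simp
  | succ n ih =>
    rw [pow_succ', ← mul_assoc, pow_succ', ← mul_assoc]
    refine (Ideal.mul_mono_left (hz.maximalIdeal_mul_colon_le hd)).trans ?_
    rw [mul_right_comm, mul_right_comm _ (cubeSpan z d)]
    exact Ideal.mul_mono_left ih

theorem colon_pow_eq [IsNoetherianRing R] (hz : IsGoodSeq z d) (hd : 2 ≤ d) (n : ℕ) :
    (cubeSpan z d).colon (maximalIdeal R) ^ (n + 2) =
      cubeSpan z d ^ (n + 1) * (cubeSpan z d).colon (maximalIdeal R) := by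
  refine le_antisymm (fun a ha => ?_) ?_
  · have h1 : a ∈ cubeSpan z d := by
      have h2 : (cubeSpan z d).colon (maximalIdeal R) ^ (n + 2) ≤ cubeSpan z d := by
        refine (Ideal.pow_le_pow_right (by omega : 2 ≤ n + 2)).trans ?_
        rw [pow_two]
        exact (Ideal.mul_mono_left (hz.colon_le_maximalIdeal hd)).trans
          ((hz.maximalIdeal_mul_colon_le hd).trans Ideal.mul_le_right)
      exact h2 ha
    obtain ⟨p, hp, s, hs, rfl⟩ := Submodule.mem_sup.1
      (hz.mem_pow_mul_colon_sup (Nat.zero_le d) (n + 1) fun r hr => Ideal.mem_sup_left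
        (Ideal.mul_le_right
          (hz.maximalIdeal_mul_colon_pow_le hd (n + 2) (Ideal.mul_mem_mul hr ha))))
    have hsq : s ∈ cubeSpan z d := by
      have := Ideal.sub_mem _ h1 (Ideal.pow_le_self (Nat.succ_ne_zero n) (Ideal.mul_le_left hp))
      simpa using this
    have := hz.mem_of_mem_saturation (Nat.zero_le d) hsq (colon_maximalIdeal_le_saturation _ hs)
    rw [cubeSpan_zero, Ideal.mem_bot] at this
    simpa [this] using hp
  · rw [pow_succ _ (n + 1)]
    exact Ideal.mul_mono_left (Ideal.pow_right_mono (le_colon_maximalIdeal _) _)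

end IsGoodSeq

/-- The sum expressing a Hilbert polynomial of degree `k` through its Hilbert coefficients. -/
def hilbertSum (k : ℕ) (e : ℕ → ℤ) (n : ℕ) : ℤ :=
  ∑ i ∈ Finset.range (k + 1), (-1 : ℤ) ^ i * e i * ((n + k - i).choose (k - i) : ℤ)

theorem hilbertSum_sub (k : ℕ) (e e' : ℕ → ℤ) (n : ℕ) :
    hilbertSum k (e - e') n = hilbertSum k e n - hilbertSum k e' n := by
  simp only [hilbertSum, ← Finset.sum_sub_distrib, Pi.sub_apply]
  exact Finset.sum_congr rfl fun i _ => by ring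

theorem hilbertSum_congr {k : ℕ} {e e' : ℕ → ℤ} (h : ∀ i ≤ k, e i = e' i) (n : ℕ) :
    hilbertSum k e n = hilbertSum k e' n :=
  Finset.sum_congr rfl fun i hi => by rw [h i (Nat.lt_succ_iff.1 (Finset.mem_range.1 hi))]

theorem hilbertSum_succ_sub (k : ℕ) (e : ℕ → ℤ) (n : ℕ) :
    hilbertSum (k + 1) e (n + 1) - hilbertSum (k + 1) e n = hilbertSum k e (n + 1) := by
  simp only [hilbertSum]
  rw [Finset.sum_range_succ _ (k + 1), Finset.sum_range_succ _ (k + 1)]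
  simp only [Nat.sub_self, Nat.choose_zero_right, add_sub_add_right_eq_sub]
  rw [← Finset.sum_sub_distrib]
  refine Finset.sum_congr rfl fun i hi => ?_
  obtain ⟨j, rfl⟩ := Nat.exists_eq_add_of_le (Nat.lt_succ_iff.1 (Finset.mem_range.1 hi))
  have h1 : n + 1 + (i + j + 1) - i = (n + 1 + j) + 1 := by omega
  have h2 : n + (i + j + 1) - i = n + 1 + j := by omega
  have h3 : i + j + 1 - i = j + 1 := by omega
  have h4 : n + 1 + (i + j) - i = n + 1 + j := by omega
  have h5 : i + j - i = j := by omega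
  rw [h1, h2, h3, h4, h5, Nat.choose_succ_succ]
  push_cast
  ring

/-- Summation raises the degree of a Hilbert polynomial and keeps its coefficients. -/
theorem exists_hilbertSum_succ {k : ℕ} {e f g : ℕ → ℤ} (hg : ∀ n ≥ 1, g n = hilbertSum k e n)
    (hf : ∀ n ≥ 1, f (n + 1) = g (n + 1) + f n) :
    ∃ e' : ℕ → ℤ, (∀ i ≤ k, e' i = e i) ∧ ∀ n ≥ 1, f n = hilbertSum (k + 1) e' n := by
  set e₀ : ℕ → ℤ := fun i => if i ≤ k then e i else 0 with he₀
  set t : ℤ := f 1 - hilbertSum (k + 1) e₀ 1 with ht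
  refine ⟨fun i => if i ≤ k then e i else (-1) ^ (k + 1) * t, fun i hi => by simp [hi], ?_⟩
  have h1 : hilbertSum (k + 1) (fun i => if i ≤ k then e i else (-1) ^ (k + 1) * t) 1 = f 1 := by
    have : f 1 = hilbertSum (k + 1) e₀ 1 + t := by rw [ht]; ring
    rw [this, hilbertSum, hilbertSum, Finset.sum_range_succ, Finset.sum_range_succ _ (k + 1)]
    have hs : ((-1 : ℤ) ^ (k + 1)) * (-1) ^ (k + 1) = 1 := by
      rw [← mul_pow]; simp
    simp only [he₀, Nat.sub_self, Nat.choose_zero_right, Nat.cast_one, mul_one,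
      if_neg (Nat.not_succ_le_self k), mul_zero, add_zero, ← mul_assoc, hs, one_mul]
    congr 1
    refine Finset.sum_congr rfl fun i hi => ?_
    rw [if_pos (Nat.lt_succ_iff.1 (Finset.mem_range.1 hi)),
      if_pos (Nat.lt_succ_iff.1 (Finset.mem_range.1 hi))]
  intro n hn
  induction n, hn using Nat.le_induction with
  | base => exact h1.symm
  | succ n hn ih =>
    have h2 := hilbertSum_succ_sub k (fun i => if i ≤ k then e i else (-1) ^ (k + 1) * t) n
    have h3 := hilbertSum_congr (k := k) (e := fun i => if i ≤ k then e i else (-1) ^ (k + 1) * t)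
      (e' := e) (fun i hi => by simp [hi]) (n + 1)
    rw [hf n hn, hg (n + 1) (by omega)]
    linarith

theorem exists_hilbertSum_sub_const (k : ℕ) (e : ℕ → ℤ) (c : ℤ) :
    ∃ e' : ℕ → ℤ, ∀ n, hilbertSum k e' n = hilbertSum k e n - c := by
  refine ⟨Function.update e k (e k - (-1) ^ k * c), fun n => ?_⟩
  rw [hilbertSum, hilbertSum, Finset.sum_range_succ, Finset.sum_range_succ]
  have hs : ((-1 : ℤ) ^ k) * (-1) ^ k = 1 := by
    rw [← mul_pow]; simp
  simp only [Nat.sub_self, Nat.choose_zero_right, Nat.cast_one, mul_one, Function.update_self,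
    mul_sub, ← mul_assoc, hs, one_mul, ← add_sub_assoc]
  congr 2
  refine Finset.sum_congr rfl fun i hi => ?_
  rw [Function.update_of_ne (Finset.mem_range.1 hi).ne]

theorem exists_hilbertSum_of_recursion {d : ℕ} {H : ℕ → ℕ → ℤ} {L : ℤ} {c : ℕ → ℤ}
    (hH : ∀ i < d, ∀ n ≥ 1, H i (n + 1) = H (i + 1) (n + 1) + H i n - c i)
    (hd : ∀ n ≥ 1, H d n = L) :
    ∃ e : ℕ → ℤ, ∀ n ≥ 1, H 0 n = hilbertSum d e n := by
  have key : ∀ k ≤ d, ∃ e : ℕ → ℤ, ∀ n ≥ 1, H (d - k) n = hilbertSum k e n := by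
    intro k
    induction k with
    | zero => exact fun _ => ⟨fun _ => L, fun n hn => by simp [hilbertSum, hd n hn]⟩
    | succ k ih =>
      intro hk
      obtain ⟨e, he⟩ := ih (by omega)
      obtain ⟨e₁, he₁⟩ := exists_hilbertSum_sub_const k e (c (d - (k + 1)))
      obtain ⟨e', -, he'⟩ := exists_hilbertSum_succ (f := H (d - (k + 1)))
        (g := fun n => H (d - k) n - c (d - (k + 1))) (fun n hn => by rw [he₁, he n hn])
        fun n hn => by
          have h1 : d - (k + 1) + 1 = d - k := by omega
          rw [hH _ (by omega) n hn, h1]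
          ring
      exact ⟨e', he'⟩
  simpa using key d le_rfl

theorem exists_hilbertSum_of_recursion' {d : ℕ} {D : ℕ → ℕ → ℤ} {c : ℤ}
    (hD : ∀ i ≤ d, ∀ n ≥ 1, D i (n + 1) = D (i + 1) (n + 1) + D i n)
    (hd : ∀ n ≥ 1, D (d + 1) n = 0) (hc : D d 1 = c) :
    ∃ e : ℕ → ℤ, e 1 = - c ∧ ∀ n ≥ 1, D 0 n = hilbertSum (d + 1) e n := by
  have key : ∀ k ≤ d, ∃ e : ℕ → ℤ, e 1 = - c ∧ ∀ n ≥ 1, D (d - k) n = hilbertSum (k + 1) e n := by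
    intro k
    induction k with
    | zero =>
      refine fun _ => ⟨fun i => if i = 1 then -c else 0, by simp, fun n hn => ?_⟩
      have h1 : D d n = c := by
        induction n, hn using Nat.le_induction with
        | base => exact hc
        | succ n hn ih => rw [hD d le_rfl n hn, hd _ (by omega), ih, zero_add]
      simp [hilbertSum, h1]
    | succ k ih =>
      intro hk
      obtain ⟨e, he1, he⟩ := ih (by omega)
      obtain ⟨e', he'e, he'⟩ := exists_hilbertSum_succ (f := D (d - (k + 1)))
        (g := D (d - k)) he fun n hn => by
          have h1 : d - (k + 1) + 1 = d - k := by omega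
          rw [hD _ (by omega) n hn, h1]
      exact ⟨e', by rw [he'e 1 (by omega), he1], he'⟩
  simpa using key d le_rfl

open Submodule in
theorem length_quotient_eq_add {A M N : Type*} [CommRing A] [AddCommGroup M] [Module A M]
    [AddCommGroup N] [Module A N] (f : M →ₗ[A] N) (P : Submodule A N) :
    Module.length A (N ⧸ P) =
      Module.length A (M ⧸ P.comap f) + Module.length A (N ⧸ P ⊔ LinearMap.range f) := by
  refine Module.length_eq_add_of_exact ((P.comap f).mapQ P f le_rfl)
    (factor (le_sup_left : P ≤ P ⊔ LinearMap.range f)) ?_ (factor_surjective _) ?_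
  · rw [← LinearMap.ker_eq_bot, ker_mapQ, mkQ_map_self]
  · rw [LinearMap.exact_iff, range_mapQ, factor, ker_mapQ, comap_id, Submodule.map_sup,
      mkQ_map_self, bot_sup_eq]

/-- The length of `K / (J ∩ K)`. -/
def relLength {A : Type*} [CommRing A] (J K : Ideal A) : ℕ∞ :=
  Module.length A (K ⧸ Submodule.comap K.subtype J)

theorem length_quotient_eq_colon_add {A : Type*} [CommRing A] {J C : Ideal A} {y : A}
    (hC : ∀ a, a ∈ C ↔ y * a ∈ J) :
    Module.length A (A ⧸ J) = Module.length A (A ⧸ C) +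
      Module.length A (A ⧸ J ⊔ Ideal.span {y}) := by
  have h1 : C = Submodule.comap (LinearMap.mulLeft A y) J := by
    ext a; exact hC a
  have h2 : Ideal.span {y} = LinearMap.range (LinearMap.mulLeft A y) := by
    ext a; simp [Ideal.mem_span_singleton', mul_comm]
  rw [h1, h2]
  exact length_quotient_eq_add _ _

theorem length_quotient_eq_relLength_add {A : Type*} [CommRing A] (J K : Ideal A) :
    Module.length A (A ⧸ J) = relLength J K + Module.length A (A ⧸ J ⊔ K) := by
  have h := length_quotient_eq_add K.subtype J
  rwa [Submodule.range_subtype] at h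

theorem relLength_congr {A : Type*} [CommRing A] {J J' K : Ideal A} (h : J ⊓ K = J' ⊓ K) :
    relLength J K = relLength J' K := by
  have : Submodule.comap K.subtype J = Submodule.comap K.subtype J' := by
    ext ⟨a, ha⟩
    have := congrArg (a ∈ ·) h
    simpa [ha] using this
  rw [relLength, this, relLength]

theorem relLength_eq_add {A : Type*} [CommRing A] {J K U : Ideal A} (hJK : J ≤ K) (hKU : K ≤ U) :
    relLength J U = relLength J K + relLength K U := by
  have h := length_quotient_eq_add (Submodule.inclusion hKU) (Submodule.comap U.subtype J)
  have h2 : Submodule.comap U.subtype J ⊔ LinearMap.range (Submodule.inclusion hKU) =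
      Submodule.comap U.subtype K := by
    rw [Submodule.range_inclusion]
    exact sup_eq_right.2 fun a ha => hJK ha
  rwa [h2] at h

theorem relLength_eq_zero_iff {A : Type*} [CommRing A] {J K : Ideal A} :
    relLength J K = 0 ↔ K ≤ J := by
  rw [relLength, Module.length_eq_zero_iff, Submodule.Quotient.subsingleton_iff,
    Submodule.comap_subtype_eq_top]

theorem indexOfReducibility_eq (q : Ideal R) :
    indexOfReducibility R q = (relLength q (q.colon (maximalIdeal R)) : ℕ∞) :=
  (Module.coe_length _ _).symm

theorem length_quotient_ne_top [IsNoetherianRing R] {J : Ideal R} {k : ℕ}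
    (h : maximalIdeal R ^ k ≤ J) : Module.length R (R ⧸ J) ≠ ⊤ := by
  by_cases hJ : J = ⊤
  · subst hJ
    rw [Module.length_eq_zero]
    exact ENat.zero_ne_top
  have hmin : maximalIdeal R ∈ J.minimalPrimes :=
    ⟨⟨inferInstance, le_maximalIdeal hJ⟩, fun P hP _ => hP.1.le_of_pow_le (h.trans hP.2)⟩
  have := IsLocalRing.quotient_artinian_of_mem_minimalPrimes_of_isLocalRing J hmin
  rw [Module.length_eq_of_surjective (R := R ⧸ J) (S := R) Ideal.Quotient.mk_surjective]
  exact Module.length_ne_top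

/-- The length of `R / J` as an integer; it is `0` if the length is infinite. -/
def quotLength {A : Type*} [CommRing A] (J : Ideal A) : ℤ := (Module.length A (A ⧸ J)).toNat

theorem quotLength_eq_sub {A : Type*} [CommRing A] {J K U : Ideal A} {y : A}
    (hJ : Module.length A (A ⧸ J) ≠ ⊤) (hK : Module.length A (A ⧸ K) ≠ ⊤)
    (h : ∀ a, a ∈ K ⊔ U ↔ y * a ∈ J) :
    quotLength J = quotLength (J ⊔ Ideal.span {y}) + quotLength K - (relLength K U).toNat := by
  have h1 := length_quotient_eq_colon_add h
  have h2 := length_quotient_eq_relLength_add K U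
  rw [h1, Ne, ENat.add_eq_top, not_or] at hJ
  rw [h2, Ne, ENat.add_eq_top, not_or] at hK
  rw [quotLength, quotLength, quotLength, h1, h2, ENat.toNat_add hJ.1 hJ.2,
    ENat.toNat_add hK.1 hK.2]
  push_cast
  ring

theorem quotLength_eq_of_le {A : Type*} [CommRing A] {J K : Ideal A}
    (hJ : Module.length A (A ⧸ J) ≠ ⊤) (hJK : J ≤ K) :
    quotLength J = (relLength J K).toNat + quotLength K := by
  have h2 := length_quotient_eq_relLength_add J K
  rw [sup_eq_right.2 hJK] at h2
  rw [h2, Ne, ENat.add_eq_top, not_or] at hJ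
  rw [quotLength, quotLength, h2, ENat.toNat_add hJ.1 hJ.2]
  push_cast
  ring

theorem isHilbertCoeffs_of_forall [IsNoetherianRing R] {d : ℕ} {I : Ideal R} {e : ℕ → ℤ}
    (hI : ∃ k : ℕ, maximalIdeal R ^ k ≤ I)
    (h : ∀ n ≥ 1, quotLength (I ^ (n + 1)) = hilbertSum d e n) : IsHilbertCoeffs R d I e := by
  obtain ⟨k, hk⟩ := hI
  refine ⟨1, fun n hn => ⟨(Module.length R (R ⧸ I ^ (n + 1))).toNat, ?_, h n hn⟩⟩
  have hfin : Module.length R (R ⧸ I ^ (n + 1)) ≠ ⊤ :=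
    length_quotient_ne_top (k := k * (n + 1)) (by rw [pow_mul]; exact Ideal.pow_right_mono hk _)
  rw [ENat.natCast_toNat hfin]
  exact (Module.coe_length _ _).symm

namespace IsGoodSeq

variable {z : ℕ → R} {d : ℕ}

theorem colon_inf_saturation (hz : IsGoodSeq z d) {i : ℕ} (hi : i ≤ d) :
    (cubeSpan z d).colon (maximalIdeal R) ⊓ saturation (cubeSpan z i) =
      (cubeSpan z i).colon (maximalIdeal R) := by
  refine le_antisymm (fun a ha => mem_colon_maximalIdeal.2 fun r hr => ?_)
    (le_inf (fun a ha => ?_) (colon_maximalIdeal_le_saturation _))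
  · exact hz.mem_of_mem_saturation hi (mem_colon_maximalIdeal.1 ha.1 r hr)
      (Ideal.mul_mem_left _ _ ha.2)
  · exact mem_colon_maximalIdeal.2 fun r hr => cubeSpan_mono z hi (mem_colon_maximalIdeal.1 ha r hr)

theorem sup_inf_saturation (hz : IsGoodSeq z d) {i : ℕ} (hi : i ≤ d) {J : Ideal R}
    (hJ : J ≤ cubeSpan z d) :
    (J ⊔ cubeSpan z i) ⊓ saturation (cubeSpan z i) =
      cubeSpan z i ⊓ saturation (cubeSpan z i) := by
  refine le_antisymm (fun a ha => ⟨?_, ha.2⟩) (inf_le_inf_right _ le_sup_right)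
  exact hz.mem_of_mem_saturation hi (sup_le hJ (cubeSpan_mono z hi) ha.1) ha.2

theorem pow_sup_ne_top [IsNoetherianRing R] (hz : IsGoodSeq z d) (n : ℕ) (J : Ideal R) :
    Module.length R (R ⧸ (cubeSpan z d ^ n ⊔ J)) ≠ ⊤ := by
  obtain ⟨k, hk⟩ := hz.pow_le
  refine length_quotient_ne_top (k := k * n) (le_sup_of_le_left ?_)
  rw [pow_mul]
  exact Ideal.pow_right_mono hk _

theorem pow_mul_colon_sup_ne_top [IsNoetherianRing R] (hz : IsGoodSeq z d) (n : ℕ) (J : Ideal R) :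
    Module.length R (R ⧸ (cubeSpan z d ^ n * (cubeSpan z d).colon (maximalIdeal R) ⊔ J)) ≠ ⊤ := by
  obtain ⟨k, hk⟩ := hz.pow_le
  refine length_quotient_ne_top (k := k * (n + 1)) (le_sup_of_le_left ?_)
  rw [pow_mul, pow_succ]
  exact Ideal.mul_mono (Ideal.pow_right_mono hk _) (hk.trans (le_colon_maximalIdeal _))

theorem relLength_ne_top [IsNoetherianRing R] (hz : IsGoodSeq z d) {i : ℕ} (hi : i ≤ d) :
    relLength (cubeSpan z i) (saturation (cubeSpan z i)) ≠ ⊤ := by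
  rw [← relLength_congr (hz.sup_inf_saturation hi (J := cubeSpan z d ^ 1) (by rw [pow_one]))]
  have h1 := length_quotient_eq_relLength_add (cubeSpan z d ^ 1 ⊔ cubeSpan z i)
    (saturation (cubeSpan z i))
  have h2 := hz.pow_sup_ne_top 1 (cubeSpan z i)
  rw [h1, Ne, ENat.add_eq_top, not_or] at h2
  exact h2.1

theorem relLength_colon_ne_top [IsNoetherianRing R] (hz : IsGoodSeq z d) {i : ℕ} (hi : i ≤ d) :
    relLength (cubeSpan z i) ((cubeSpan z i).colon (maximalIdeal R)) ≠ ⊤ := by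
  have h := hz.relLength_ne_top hi
  rw [relLength_eq_add (le_colon_maximalIdeal (cubeSpan z i))
    (colon_maximalIdeal_le_saturation (cubeSpan z i)), Ne, ENat.add_eq_top, not_or] at h
  exact h.1

theorem quotLength_pow_sup [IsNoetherianRing R] (hz : IsGoodSeq z d) {i : ℕ} (hi : i < d) (n : ℕ) :
    quotLength (cubeSpan z d ^ (n + 2) ⊔ cubeSpan z i) =
      quotLength (cubeSpan z d ^ (n + 2) ⊔ cubeSpan z (i + 1)) +
        quotLength (cubeSpan z d ^ (n + 1) ⊔ cubeSpan z i) -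
        (relLength (cubeSpan z i) (saturation (cubeSpan z i))).toNat := by
  have hs : cubeSpan z d ^ (n + 2) ⊔ cubeSpan z (i + 1) =
      cubeSpan z d ^ (n + 2) ⊔ cubeSpan z i ⊔ Ideal.span {z i ^ 3} := by
    rw [cubeSpan_succ, sup_assoc, sup_comm (Ideal.span _)]
  rw [← relLength_congr (hz.sup_inf_saturation hi.le (Ideal.pow_le_self n.succ_ne_zero)), hs]
  refine quotLength_eq_sub (hz.pow_sup_ne_top _ _) (hz.pow_sup_ne_top _ _) fun a => ⟨fun ha => ?_,
    fun ha => ?_⟩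
  · obtain ⟨b, hb, u, hu, rfl⟩ := Submodule.mem_sup.1 ha
    obtain ⟨b', hb', w, hw, rfl⟩ := Submodule.mem_sup.1 hb
    rw [mul_add, mul_add, add_assoc]
    refine Submodule.add_mem_sup ?_ (add_mem (Ideal.mul_mem_left _ _ hw)
      (hz.pow_three_mul_mem le_rfl hi hu))
    rw [pow_succ']
    exact Ideal.mul_mem_mul (pow_three_mem_cubeSpan z hi) hb'
  · exact mem_sup_of_le le_sup_left le_rfl (hz.mem_pow_sup_of_mul_mem (n + 1) hi ha)

theorem quotLength_pow_mul_colon_sup [IsNoetherianRing R] (hz : IsGoodSeq z d) {i : ℕ} (hi : i < d)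
    (n : ℕ) :
    quotLength (cubeSpan z d ^ (n + 1) * (cubeSpan z d).colon (maximalIdeal R) ⊔ cubeSpan z i) =
      quotLength (cubeSpan z d ^ (n + 1) * (cubeSpan z d).colon (maximalIdeal R) ⊔
        cubeSpan z (i + 1)) +
      quotLength (cubeSpan z d ^ n * (cubeSpan z d).colon (maximalIdeal R) ⊔ cubeSpan z i) -
      (relLength (cubeSpan z d ^ n * (cubeSpan z d).colon (maximalIdeal R) ⊔ cubeSpan z i)
        (saturation (cubeSpan z i))).toNat := by
  have hs : cubeSpan z d ^ (n + 1) * (cubeSpan z d).colon (maximalIdeal R) ⊔ cubeSpan z (i + 1) =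
      cubeSpan z d ^ (n + 1) * (cubeSpan z d).colon (maximalIdeal R) ⊔ cubeSpan z i ⊔
        Ideal.span {z i ^ 3} := by
    rw [cubeSpan_succ, sup_assoc, sup_comm (Ideal.span _)]
  rw [hs]
  refine quotLength_eq_sub (hz.pow_mul_colon_sup_ne_top _ _) (hz.pow_mul_colon_sup_ne_top _ _)
    fun a => ⟨fun ha => ?_, fun ha => ?_⟩
  · obtain ⟨b, hb, u, hu, rfl⟩ := Submodule.mem_sup.1 ha
    obtain ⟨b', hb', w, hw, rfl⟩ := Submodule.mem_sup.1 hb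
    rw [mul_add, mul_add, add_assoc]
    refine Submodule.add_mem_sup ?_ (add_mem (Ideal.mul_mem_left _ _ hw)
      (hz.pow_three_mul_mem le_rfl hi hu))
    rw [pow_succ', mul_assoc]
    exact Ideal.mul_mem_mul (pow_three_mem_cubeSpan z hi) hb'
  · exact mem_sup_of_le le_sup_left le_rfl (hz.mem_pow_mul_colon_sup_saturation n hi ha)

/-- If `N = 𝒩(q)`, the Hilbert coefficients of `q` and `q : m` satisfy
`e₁(q : m) - e₁(q) = N - ℓ((Q : m) / Q)`, where `Q` is generated by all but the last of
the generators of `q`. -/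
theorem exists_isHilbertCoeffs [IsNoetherianRing R] {k : ℕ} (hz : IsGoodSeq z (k + 1))
    (hk : 1 ≤ k) :
    ∃ eI eQ : ℕ → ℤ,
      IsHilbertCoeffs R (k + 1) ((cubeSpan z (k + 1)).colon (maximalIdeal R)) eI ∧
      IsHilbertCoeffs R (k + 1) (cubeSpan z (k + 1)) eQ ∧
      eI 1 - eQ 1 = (relLength (cubeSpan z (k + 1))
          ((cubeSpan z (k + 1)).colon (maximalIdeal R))).toNat -
        (relLength (cubeSpan z k) ((cubeSpan z k).colon (maximalIdeal R))).toNat := by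
  set q := cubeSpan z (k + 1) with hq
  set I := q.colon (maximalIdeal R) with hI
  have hqI : q ≤ I := le_colon_maximalIdeal q
  set H : ℕ → ℕ → ℤ := fun i n => quotLength (q ^ (n + 1) ⊔ cubeSpan z i) with hH
  set G : ℕ → ℕ → ℤ := fun i n => quotLength (q ^ n * I ⊔ cubeSpan z i) with hG
  set c : ℕ → ℤ := fun i => (relLength (cubeSpan z i) (saturation (cubeSpan z i))).toNat with hc
  set s : ℤ :=
    ((relLength (cubeSpan z k) ((cubeSpan z k).colon (maximalIdeal R))).toNat : ℤ) with hs
  have hHrec : ∀ i < k + 1, ∀ n, H i (n + 1) = H (i + 1) (n + 1) + H i n - c i :=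
    fun i hi n => hz.quotLength_pow_sup hi n
  have hGrec : ∀ i < k + 1, ∀ n ≥ 1, G i (n + 1) = G (i + 1) (n + 1) + G i n - c i := by
    intro i hi n hn
    have h1 := hz.quotLength_pow_mul_colon_sup hi n
    rwa [relLength_congr (hz.sup_inf_saturation hi.le
      (Ideal.mul_le_left.trans (Ideal.pow_le_self (by omega))))] at h1
  have hGrec0 : G k 1 = G (k + 1) 1 + G k 0 - (c k - s) := by
    have h1 := hz.quotLength_pow_mul_colon_sup (i := k) (by omega) 0
    have h2 : (cubeSpan z (k + 1) ^ 0 * (cubeSpan z (k + 1)).colon (maximalIdeal R) ⊔ cubeSpan z k)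
        ⊓ saturation (cubeSpan z k) =
        (cubeSpan z k).colon (maximalIdeal R) ⊓ saturation (cubeSpan z k) := by
      rw [pow_zero, one_mul, sup_eq_left.2 ((cubeSpan_mono z k.le_succ).trans
        (le_colon_maximalIdeal _)), hz.colon_inf_saturation k.le_succ,
        inf_eq_left.2 (colon_maximalIdeal_le_saturation _)]
    have h3 := relLength_eq_add (le_colon_maximalIdeal (cubeSpan z k))
      (colon_maximalIdeal_le_saturation (cubeSpan z k))
    have h4 := hz.relLength_ne_top k.le_succ
    rw [h3, Ne, ENat.add_eq_top, not_or] at h4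
    have h5 : c k - s = (relLength ((cubeSpan z k).colon (maximalIdeal R))
        (saturation (cubeSpan z k))).toNat := by
      simp only [hc, hs]
      rw [h3, ENat.toNat_add h4.1 h4.2]
      push_cast
      ring
    rw [h5, ← relLength_congr h2]
    exact h1
  have hHd : ∀ n, H (k + 1) n = quotLength q := fun n => by
    simp only [hH]
    rw [sup_eq_right.2 (Ideal.pow_le_self n.succ_ne_zero)]
  have hGd : ∀ n ≥ 1, G (k + 1) n = quotLength q := fun n hn => by
    simp only [hG]
    rw [sup_eq_right.2 (Ideal.mul_le_left.trans (Ideal.pow_le_self (by omega)))]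
  have hH0 : H k 0 = quotLength q := by
    simp only [hH]
    rw [zero_add, pow_one, sup_eq_left.2 (cubeSpan_mono z k.le_succ)]
  have hG0 : G k 0 = quotLength I := by
    simp only [hG]
    rw [pow_zero, one_mul, sup_eq_left.2 ((cubeSpan_mono z k.le_succ).trans hqI)]
  have hfin : Module.length R (R ⧸ q) ≠ ⊤ := by
    have := hz.pow_sup_ne_top 1 ⊥
    rwa [pow_one, sup_bot_eq] at this
  have hqIlen := quotLength_eq_of_le hfin hqI
  obtain ⟨eQ, heQ⟩ := exists_hilbertSum_of_recursion (H := H) (d := k + 1)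
    (fun i hi n _ => hHrec i hi n) (fun n _ => hHd n)
  obtain ⟨eD, heD1, heD⟩ := exists_hilbertSum_of_recursion' (D := fun i n => H i n - G i n)
    (d := k) (c := (relLength q I).toNat - s)
    (fun i hi n hn => by
      simp only [hHrec i (by omega) n, hGrec i (by omega) n hn]
      ring)
    (fun n hn => by simp only [hHd n, hGd n hn, sub_self])
    (by
      have h1 := hHrec k (by omega) 0
      simp only [zero_add] at h1
      simp only [h1, hGrec0, hHd, hGd 1 le_rfl, hH0, hG0, hqIlen]
      ring)
  have hpow := hz.pow_le
  refine ⟨eQ - eD, eQ, isHilbertCoeffs_of_forall (hpow.imp fun _ h => h.trans hqI) fun n hn => ?_,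
    isHilbertCoeffs_of_forall hpow fun n hn => ?_, by rw [Pi.sub_apply, heD1]; ring⟩
  · obtain ⟨m, rfl⟩ := Nat.exists_eq_add_of_le' hn
    rw [hilbertSum_sub, ← heQ _ hn, ← heD _ hn, sub_sub_cancel, hI, hq,
      hz.colon_pow_eq (by omega)]
    simp only [hG, cubeSpan_zero, sup_bot_eq, hI, hq]
  · rw [← heQ n hn]
    simp only [hH, cubeSpan_zero, sup_bot_eq]

end IsGoodSeq

theorem subsingleton_ext_iff_forall_exists {A : Type} [CommRing A] {X : ModuleCat.{0} A}
    (P : ProjectiveResolution X) (Y : ModuleCat.{0} A) (n : ℕ) :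
    Subsingleton (((Ext A (ModuleCat A) n).obj (Opposite.op X)).obj Y) ↔
      ∀ f : P.complex.X n ⟶ Y, P.complex.d (n + 1) n ≫ f = 0 →
        ∃ g : P.complex.X ((ComplexShape.up ℕ).prev n) ⟶ Y,
          P.complex.d n ((ComplexShape.up ℕ).prev n) ≫ g = f := by
  rw [← ModuleCat.isZero_iff_subsingleton, (P.isoExt (R := A) n Y).isZero_iff,
    ← HomologicalComplex.exactAt_iff_isZero_homology,
    HomologicalComplex.exactAt_iff' _ _ n (n + 1) rfl (by simp),
    ShortComplex.moduleCat_exact_iff]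
  rfl

theorem subsingleton_abelianExt_iff_forall_exists {A : Type} [CommRing A] {X : ModuleCat.{0} A}
    (P : ProjectiveResolution X) (Y : ModuleCat.{0} A) (n : ℕ) :
    Subsingleton (Abelian.Ext X Y n) ↔
      ∀ f : P.complex.X n ⟶ Y, P.complex.d (n + 1) n ≫ f = 0 →
        ∃ g : P.complex.X ((ComplexShape.up ℕ).prev n) ⟶ Y,
          P.complex.d n ((ComplexShape.up ℕ).prev n) ≫ g = f := by
  cases n with
  | zero =>
    have hd : P.complex.d 0 ((ComplexShape.up ℕ).prev 0) = 0 := P.complex.shape _ _ (by simp)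
    rw [Abelian.Ext.addEquiv₀.subsingleton_congr, hd]
    constructor
    · intro h f hf
      have hf' : f = P.π.f 0 ≫ P.exact₀.desc f hf := (P.exact₀.g_desc f hf).symm
      refine ⟨0, ?_⟩
      rw [hf', show P.exact₀.desc f hf = 0 from Subsingleton.elim (α := X ⟶ Y) _ _]
      exact Limits.zero_comp.trans Limits.comp_zero.symm
    · intro h
      refine (subsingleton_iff_forall_eq (0 : X ⟶ Y)).2
        fun (a : ((ChainComplex.single₀ (ModuleCat A)).obj X).X 0 ⟶ Y) => ?_
      obtain ⟨g, hg⟩ := h (P.π.f 0 ≫ a) <| (Category.assoc _ _ _).symm.trans <|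
        (congrArg (· ≫ a) P.complex_d_comp_π_f_zero).trans Limits.zero_comp
      rw [Limits.zero_comp] at hg
      exact (cancel_epi (P.π.f 0)).1 (hg.symm.trans Limits.comp_zero.symm)
  | succ p =>
    have hp : (ComplexShape.up ℕ).prev (p + 1) = p := by simp
    rw [hp]
    constructor
    · intro h f hf
      exact (P.extMk_eq_zero_iff f (p + 2) rfl hf p rfl).1 (Subsingleton.elim _ _)
    · intro h
      rw [subsingleton_iff_forall_eq 0]
      intro α
      obtain ⟨f, hf, rfl⟩ := P.extMk_surjective α (p + 2) rfl
      exact (P.extMk_eq_zero_iff f (p + 2) rfl hf p rfl).2 (h f hf)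

theorem subsingleton_ext_iff {A : Type} [CommRing A] (X Y : ModuleCat.{0} A) (n : ℕ) :
    Subsingleton (((Ext A (ModuleCat A) n).obj (Opposite.op X)).obj Y) ↔
      Subsingleton (Abelian.Ext X Y n) :=
  (subsingleton_ext_iff_forall_exists (projectiveResolution X) Y n).trans
    (subsingleton_abelianExt_iff_forall_exists (projectiveResolution X) Y n).symm

theorem support_residueField :
    Module.support R (ResidueField R) = PrimeSpectrum.zeroLocus (maximalIdeal R : Set R) := by
  have h : Module.support R (R ⧸ maximalIdeal R) = _ :=
    Module.support_eq_zeroLocus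
  rwa [Ideal.annihilator_quotient] at h

open RingTheory.Sequence in
theorem isCohenMacaulay_of_isRegular [IsNoetherianRing R] {d : ℕ} (hdim : ringKrullDim R = d)
    {rs : List R} (hlen : rs.length = d) (hmem : ∀ r ∈ rs, r ∈ maximalIdeal R)
    (hreg : IsRegular R rs) : IsCohenMacaulay R := by
  have hlt : maximalIdeal R • (⊤ : Submodule R (ModuleCat.of R R)) < ⊤ := by
    have : maximalIdeal R • (⊤ : Ideal R) < ⊤ := by
      rw [smul_eq_mul, Ideal.mul_top]
      exact lt_top_iff_ne_top.2 Ideal.IsPrime.ne_top'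
    exact this
  have hfin : Module.Finite R (ResidueField R) :=
    Module.Finite.of_surjective (Algebra.linearMap R (ResidueField R)) residue_surjective
  have hlow : ∀ i < d, Subsingleton (((Ext R (ModuleCat R) i).obj
      (Opposite.op (ModuleCat.of R (ResidueField R)))).obj (ModuleCat.of R R)) := by
    intro i hi
    rw [subsingleton_ext_iff]
    exact ModuleCat.subsingleton_ext_of_exists_isRegular (maximalIdeal R)
      (ModuleCat.of R (ResidueField R)) support_residueField.subset (ModuleCat.of R R) hlt rs hmem
      hreg i (hi.trans_eq hlen.symm)
  have hd : Nontrivial (((Ext R (ModuleCat R) d).obj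
      (Opposite.op (ModuleCat.of R (ResidueField R)))).obj (ModuleCat.of R R)) := by
    rw [← not_subsingleton_iff_nontrivial]
    intro hsub
    obtain ⟨rs', hlen', -, hreg'⟩ := ModuleCat.exists_isRegular_of_exists_subsingleton_ext
      (maximalIdeal R) (d + 1) (ModuleCat.of R R) hlt (ModuleCat.of R (ResidueField R))
      support_residueField fun i hi => by
        rw [← subsingleton_ext_iff]
        rcases Nat.lt_succ_iff_lt_or_eq.1 hi with hi | rfl
        exacts [hlow i hi, hsub]
    have h1 := ringKrullDim_add_length_eq_ringKrullDim_of_isRegular rs' hreg'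
    have h2 : Nontrivial (R ⧸ Ideal.ofList rs') := by
      refine Ideal.Quotient.nontrivial_iff.2 fun h => hreg'.top_ne_smul ?_
      have : (⊤ : Ideal R) = Ideal.ofList rs' • ⊤ := by rw [h]; simp
      exact this
    have h3 : (0 : WithBot ℕ∞) ≤ ringKrullDim (R ⧸ Ideal.ofList rs') :=
      ringKrullDim_nonneg_of_nontrivial
    rw [hdim, hlen'] at h1
    have h4 : (0 : WithBot ℕ∞) + ((d + 1 : ℕ) : WithBot ℕ∞) ≤ (d : WithBot ℕ∞) :=
      (add_le_add_left h3 _).trans_eq h1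
    rw [zero_add] at h4
    have h5 : d + 1 ≤ d := by exact_mod_cast h4
    omega
  have hdepth : extDepth R = d := by
    refine le_antisymm (sInf_le ⟨d, rfl, hd⟩) (le_sInf ?_)
    rintro _ ⟨m, rfl, hm⟩
    by_contra! hlt
    exact not_subsingleton_iff_nontrivial.2 hm (hlow m (by exact_mod_cast hlt))
  rw [IsCohenMacaulay, hdepth, hdim]
  rfl

theorem saturation_le_of_colon_le {J : Ideal R} (h : J.colon (maximalIdeal R) ≤ J) :
    saturation J ≤ J := by
  rintro a ⟨k, hk⟩
  induction k generalizing a with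
  | zero => simpa using hk 1 (by simp)
  | succ k ih =>
    refine h (mem_colon_maximalIdeal.2 fun r hr => ih fun s hs => ?_)
    rw [← mul_assoc]
    exact hk _ (by rw [pow_succ]; exact Ideal.mul_mem_mul hs hr)

namespace IsGoodSeq

variable {z : ℕ → R} {d : ℕ}

theorem saturation_le_of_saturation_succ_le [IsNoetherianRing R] (hz : IsGoodSeq z d) {i : ℕ}
    (hi : i < d) (h : saturation (cubeSpan z (i + 1)) ≤ cubeSpan z (i + 1)) :
    saturation (cubeSpan z i) ≤ cubeSpan z i := by
  refine Submodule.le_of_le_smul_of_le_jacobson_bot (I := maximalIdeal R)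
    (IsNoetherian.noetherian _) (maximalIdeal_le_jacobson _) fun a ha => ?_
  obtain ⟨c, p, hp, rfl⟩ := mem_cubeSpan_succ.1 (h (saturation_mono (cubeSpan_mono z i.le_succ) ha))
  have hc : c ∈ saturation (cubeSpan z i) := hz.regular_pow_three le_rfl hi
    ((add_mem_cancel_right (le_saturation _ hp)).1 ha)
  rw [add_comm]
  exact Submodule.add_mem_sup hp (Submodule.smul_mem_smul (hz.pow_three_mem_max hi) hc)

theorem isRegular_of_saturation_le [IsNoetherianRing R] (hz : IsGoodSeq z d)
    (h : ∀ i < d, saturation (cubeSpan z i) ≤ cubeSpan z i) :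
    RingTheory.Sequence.IsRegular R ((List.range d).map fun i => z i ^ 3) := by
  have hlist : ∀ i ≤ d, Ideal.ofList (((List.range d).map fun i => z i ^ 3).take i) =
      cubeSpan z i := by
    intro i hi
    rw [Ideal.ofList, cubeSpan, ← List.map_take, List.take_range, min_eq_left hi]
    congr 1
    ext a
    simp
  refine ⟨⟨fun i hi => ?_⟩, fun htop => ?_⟩
  · have hid : i < d := by simpa using hi
    rw [hlist i hid.le, smul_eq_mul, Ideal.mul_top]
    rw [isSMulRegular_iff_right_eq_zero_of_smul]
    intro x hx
    obtain ⟨a, rfl⟩ := Submodule.Quotient.mk_surjective _ x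
    rw [← Submodule.Quotient.mk_smul, Submodule.Quotient.mk_eq_zero] at hx
    rw [Submodule.Quotient.mk_eq_zero]
    refine h i hid (hz.regular_pow_three le_rfl hid (le_saturation _ ?_))
    simpa using hx
  · have h1 := hlist d le_rfl
    rw [List.take_of_length_le (by simp)] at h1
    rw [h1, smul_eq_mul, Ideal.mul_top] at htop
    exact Ideal.IsPrime.ne_top' (top_le_iff.1 (htop.trans_le hz.cubeSpan_le_maximalIdeal))

theorem isParameterIdeal (hz : IsGoodSeq z d) : IsParameterIdeal R d (cubeSpan z d) := by
  refine ⟨⟨fun j => z j ^ 3, ?_⟩, le_antisymm ?_ ?_⟩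
  · rw [cubeSpan]
    congr 1
    ext a
    simp [Fin.exists_iff]
  · exact (Ideal.radical_mono hz.cubeSpan_le_maximalIdeal).trans_eq
      (Ideal.IsPrime.radical inferInstance)
  · obtain ⟨k, hk⟩ := hz.pow_le
    exact fun r hr => ⟨k, hk (Ideal.pow_mem_pow hr k)⟩

end IsGoodSeq
end

/-- Proposition 3.5: let `R` be an unmixed Noetherian local ring of dimension `d ≥ 2` with
infinite residue field, and suppose that there is an integer `n` such that every parameter
ideal `𝔮 ⊆ 𝔪ⁿ` satisfies `𝒩(𝔮;R) ≤ e₁(𝔮:𝔪) - e₁(𝔮)`. Then `R` is Cohen–Macaulay. -/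
theorem stmt_8 [IsNoetherianRing R] (d : ℕ)
    (hdim : ringKrullDim R = (d : WithBot ℕ∞)) (hd : 2 ≤ d)
    (hres : Infinite (ResidueField R)) (hunmixed : IsUnmixed R d)
    (h : ∃ n : ℕ, ∀ q : Ideal R, IsParameterIdeal R d q → q ≤ maximalIdeal R ^ n →
      ∀ eI eQ : ℕ → ℤ, IsHilbertCoeffs R d (q.colon (maximalIdeal R)) eI →
        IsHilbertCoeffs R d q eQ →
        ∀ Nq : ℕ, indexOfReducibility R q = (Nq : ℕ∞) → (Nq : ℤ) ≤ eI 1 - eQ 1) :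
    IsCohenMacaulay R := by
  obtain ⟨n, h⟩ := h
  obtain ⟨z, hz, hzn⟩ := exists_isGoodSeq hdim n
  obtain ⟨k, rfl⟩ := Nat.exists_eq_add_of_le' (show 1 ≤ d by omega)
  obtain ⟨eI, eQ, hI, hQ, he⟩ := hz.exists_isHilbertCoeffs (by omega)
  have hle := h _ hz.isParameterIdeal hzn eI eQ hI hQ
    (relLength (cubeSpan z (k + 1)) ((cubeSpan z (k + 1)).colon (maximalIdeal R))).toNat (by
      rw [indexOfReducibility_eq, ENat.natCast_toNat (hz.relLength_colon_ne_top le_rfl)])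
  have hcolon : (cubeSpan z k).colon (maximalIdeal R) ≤ cubeSpan z k := by
    rw [← relLength_eq_zero_iff, ← ENat.natCast_toNat (hz.relLength_colon_ne_top k.le_succ),
      Nat.cast_eq_zero]
    omega
  have hsat : ∀ i ≤ k, saturation (cubeSpan z i) ≤ cubeSpan z i := by
    intro i hi
    induction hi using Nat.decreasingInduction with
    | self => exact saturation_le_of_colon_le hcolon
    | of_succ i hi ih => exact hz.saturation_le_of_saturation_succ_le (by omega) ih
  refine isCohenMacaulay_of_isRegular hdim (by simp) ?_
    (hz.isRegular_of_saturation_le fun i hi => hsat i (by omega))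
  simpa using fun i hi => hz.pow_three_mem_max (Nat.lt_succ_iff.2 hi)

end
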